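/- arXiv:1410.4976 — 13 statements merged into one kernel-verified Lean document; each statement's English description precedes it below -/
import Mathlib

section
/- Let A, B ∈ SL(2,ℂ) and set a = tr(A), b = tr(B), c = tr(AB). Then A and B have a common eigenvector in ℂ² if and only if a² + b² + c² − abc − 2 = 2. -/
/-!
STATEMENT 1: For A, B ∈ SL(2,ℂ) with a = tr(A), b = tr(B), c = tr(AB), the matrices A and B
have a common eigenvector in ℂ² if and only if a² + b² + c² − abc − 2 = 2.
-/

open Matrix
open scoped MatrixGroups

/-- `A` and `B` have a common eigenvector in `ℂ²`. -/
def HasCommonEigenvector (A B : SL(2, ℂ)) : Prop :=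
  ∃ v : Fin 2 → ℂ, v ≠ 0 ∧
    (∃ μ : ℂ, (A : Matrix (Fin 2) (Fin 2) ℂ) *ᵥ v = μ • v) ∧
    (∃ ν : ℂ, (B : Matrix (Fin 2) (Fin 2) ℂ) *ᵥ v = ν • v)

/-- The binary quadratic form `det (v | M v)`, whose nontrivial zeros are the eigenvectors of `M`. -/
def eigenForm {K : Type*} [Field K] (M : Matrix (Fin 2) (Fin 2) K) (v : Fin 2 → K) : K :=
  M 1 0 * v 0 ^ 2 + (M 1 1 - M 0 0) * (v 0 * v 1) - M 0 1 * v 1 ^ 2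

theorem exists_mulVec_eq_smul_of_eigenForm_eq_zero {K : Type*} [Field K]
    {M : Matrix (Fin 2) (Fin 2) K} {v : Fin 2 → K} (hv : v ≠ 0) (h : eigenForm M v = 0) :
    ∃ μ : K, M *ᵥ v = μ • v := by
  unfold eigenForm at h
  by_cases h0 : v 0 = 0
  · have h1 : v 1 ≠ 0 := fun h1 => hv (by ext i; fin_cases i <;> simp [h0, h1])
    have hM : M 0 1 = 0 := by simpa [h0, h1] using h
    refine ⟨M 1 1, ?_⟩
    ext i
    fin_cases i <;> simp [mulVec, dotProduct, Fin.sum_univ_two, h0, hM]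
  · refine ⟨(M 0 0 * v 0 + M 0 1 * v 1) / v 0, ?_⟩
    ext i
    fin_cases i
    · simp [mulVec, dotProduct, Fin.sum_univ_two, h0]
    · simp only [mulVec, dotProduct, Fin.sum_univ_two, Fin.mk_one, Pi.smul_apply, smul_eq_mul]
      field_simp
      linear_combination h

theorem exists_ne_zero_eigenForm_eq_zero {K : Type*} [Field K] [IsAlgClosed K]
    (M : Matrix (Fin 2) (Fin 2) K) : ∃ v : Fin 2 → K, v ≠ 0 ∧ eigenForm M v = 0 := by
  obtain ⟨μ, hμ⟩ := Module.End.exists_eigenvalue (Matrix.toLin' M)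
  obtain ⟨v, hv⟩ := hμ.exists_hasEigenvector
  have h : M *ᵥ v = μ • v := by simpa using hv.apply_eq_smul
  have h0 := congrFun h 0
  have h1 := congrFun h 1
  simp only [mulVec, dotProduct, Fin.sum_univ_two, Pi.smul_apply, smul_eq_mul] at h0 h1
  refine ⟨v, hv.2, ?_⟩
  unfold eigenForm
  linear_combination v 0 * h1 - v 1 * h0

theorem det_commutator_eq_zero_of_common_eigenvector {K : Type*} [Field K]
    {M N : Matrix (Fin 2) (Fin 2) K} {v : Fin 2 → K} {μ ν : K} (hv : v ≠ 0)
    (hM : M *ᵥ v = μ • v) (hN : N *ᵥ v = ν • v) : (M * N - N * M).det = 0 := by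
  refine exists_mulVec_eq_zero_iff.mp ⟨v, hv, ?_⟩
  rw [sub_mulVec, ← mulVec_mulVec, ← mulVec_mulVec, hM, hN, mulVec_smul, mulVec_smul, hM, hN,
    smul_comm, sub_self]

/-- For commuting matrices the eigenforms are proportional. -/
theorem exists_common_zero_eigenForm_of_commute {K : Type*} [Field K] [IsAlgClosed K]
    {M N : Matrix (Fin 2) (Fin 2) K} (h : M * N = N * M) :
    ∃ v : Fin 2 → K, v ≠ 0 ∧ eigenForm M v = 0 ∧ eigenForm N v = 0 := by
  have h00 := congrFun (congrFun h 0) 0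
  have h01 := congrFun (congrFun h 0) 1
  have h10 := congrFun (congrFun h 1) 0
  simp only [mul_apply, Fin.sum_univ_two] at h00 h01 h10
  by_cases hs : M 1 0 = 0 ∧ M 0 1 = 0 ∧ M 1 1 - M 0 0 = 0
  · obtain ⟨v, hv, hN⟩ := exists_ne_zero_eigenForm_eq_zero N
    exact ⟨v, hv, by simp [eigenForm, hs], hN⟩
  · obtain ⟨v, hv, hM⟩ := exists_ne_zero_eigenForm_eq_zero M
    refine ⟨v, hv, hM, ?_⟩
    unfold eigenForm at hM ⊢
    by_contra hN
    refine hs ⟨?_, ?_, ?_⟩ <;> refine (mul_eq_zero.mp ?_).resolve_right hN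
    · linear_combination N 1 0 * hM - v 0 * v 1 * h10 + v 1 ^ 2 * h00
    · linear_combination N 0 1 * hM + v 0 * v 1 * h01 + v 0 ^ 2 * h00
    · linear_combination (N 1 1 - N 0 0) * hM + v 0 ^ 2 * h10 + v 1 ^ 2 * h01

/-- Any nonzero column of a singular commutator is a common eigenvector. -/
theorem eigenForm_col_commutator_eq_zero {K : Type*} [Field K]
    {M N : Matrix (Fin 2) (Fin 2) K} (h : (M * N - N * M).det = 0) (j : Fin 2) :
    eigenForm M (fun i => (M * N - N * M) i j) = 0 ∧
      eigenForm N (fun i => (M * N - N * M) i j) = 0 := by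
  simp only [det_fin_two, Matrix.sub_apply, mul_apply, Fin.sum_univ_two] at h
  fin_cases j <;>
    simp only [eigenForm, Matrix.sub_apply, mul_apply, Fin.sum_univ_two, Fin.zero_eta, Fin.mk_one]
  · exact ⟨by linear_combination -M 1 0 * h, by linear_combination -N 1 0 * h⟩
  · exact ⟨by linear_combination M 0 1 * h, by linear_combination N 0 1 * h⟩

theorem hasCommonEigenvector_iff_det_commutator_eq_zero (A B : SL(2, ℂ)) :
    HasCommonEigenvector A B ↔
      ((A : Matrix (Fin 2) (Fin 2) ℂ) * (B : Matrix (Fin 2) (Fin 2) ℂ) -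
        (B : Matrix (Fin 2) (Fin 2) ℂ) * (A : Matrix (Fin 2) (Fin 2) ℂ)).det = 0 := by
  constructor
  · rintro ⟨v, hv, ⟨μ, hμ⟩, ν, hν⟩
    exact det_commutator_eq_zero_of_common_eigenvector hv hμ hν
  · intro h
    obtain ⟨v, hv, hA, hB⟩ : ∃ v : Fin 2 → ℂ, v ≠ 0 ∧
        eigenForm (A : Matrix (Fin 2) (Fin 2) ℂ) v = 0 ∧
        eigenForm (B : Matrix (Fin 2) (Fin 2) ℂ) v = 0 := by
      by_cases hcomm : (A : Matrix (Fin 2) (Fin 2) ℂ) * (B : Matrix (Fin 2) (Fin 2) ℂ) =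
          (B : Matrix (Fin 2) (Fin 2) ℂ) * (A : Matrix (Fin 2) (Fin 2) ℂ)
      · exact exists_common_zero_eigenForm_of_commute hcomm
      · by_contra hcol
        refine hcomm (sub_eq_zero.mp ?_)
        ext i j
        by_contra hij
        exact hcol ⟨_, fun h0 => hij (congrFun h0 i), eigenForm_col_commutator_eq_zero h j⟩
    exact ⟨v, hv, exists_mulVec_eq_smul_of_eigenForm_eq_zero hv hA,
      exists_mulVec_eq_smul_of_eigenForm_eq_zero hv hB⟩

/-- Fricke's trace identity, in terms of the additive commutator. -/
theorem det_commutator_eq_of_det_eq_one {K : Type*} [Field K]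
    {M N : Matrix (Fin 2) (Fin 2) K} (hM : M.det = 1) (hN : N.det = 1) :
    (M * N - N * M).det =
      4 - (M.trace ^ 2 + N.trace ^ 2 + (M * N).trace ^ 2 - M.trace * N.trace * (M * N).trace) := by
  have key : (M * N - N * M).det = 4 * M.det * N.det - (M.trace ^ 2 * N.det + N.trace ^ 2 * M.det +
      (M * N).trace ^ 2 - M.trace * N.trace * (M * N).trace) := by
    simp only [det_fin_two, trace_fin_two, Matrix.sub_apply, mul_apply, Fin.sum_univ_two]
    ring
  simpa [hM, hN] using key

theorem common_eigenvector_iff_trace_relation (A B : SL(2, ℂ))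
    (a b c : ℂ)
    (ha : a = Matrix.trace (A : Matrix (Fin 2) (Fin 2) ℂ))
    (hb : b = Matrix.trace (B : Matrix (Fin 2) (Fin 2) ℂ))
    (hc : c = Matrix.trace ((A * B : SL(2, ℂ)) : Matrix (Fin 2) (Fin 2) ℂ)) :
    HasCommonEigenvector A B ↔ a ^ 2 + b ^ 2 + c ^ 2 - a * b * c - 2 = 2 := by
  rw [ha, hb, hc, Matrix.SpecialLinearGroup.coe_mul,
    hasCommonEigenvector_iff_det_commutator_eq_zero,
    det_commutator_eq_of_det_eq_one A.det_coe B.det_coe]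
  constructor <;> intro h <;> linear_combination -h
end

section
/- Let A, B ∈ SL(2,ℂ) with a = tr(A), b = tr(B), c = tr(AB), and suppose a² + b² + c² − abc ≠ 4. Let γ ∈ ℂ, γ ≠ 0, satisfy γ + γ⁻¹ = c. Then there exists P ∈ SL(2,ℂ) such that P⁻¹AP equals the matrix with rows (a, −1) and (1, 0), and P⁻¹BP equals the matrix with rows (0, γ⁻¹) and (−γ, b). -/
/-!
STATEMENT 2: Let A, B ∈ SL(2,ℂ) with a = tr(A), b = tr(B), c = tr(AB), and suppose
a² + b² + c² − abc ≠ 4. Let γ ∈ ℂ, γ ≠ 0, with γ + γ⁻¹ = c. Then there exists P ∈ SL(2,ℂ)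
such that P⁻¹AP = !![a, −1; 1, 0] and P⁻¹BP = !![0, γ⁻¹; −γ, b].
-/

open Matrix
open scoped MatrixGroups

/-- A scalar `μ` is an eigenvalue of a `2 × 2` matrix `M` of determinant one iff
`μ² - tr(M) μ + 1 = 0`. -/
lemma exists_mulVec_eq_smul_iff {K : Type*} [Field K] {M : Matrix (Fin 2) (Fin 2) K}
    (hM : M.det = 1) (μ : K) :
    (∃ v : Fin 2 → K, v ≠ 0 ∧ M *ᵥ v = μ • v) ↔ μ ^ 2 - M.trace * μ + 1 = 0 := by
  have hdet : (M - μ • 1).det = μ ^ 2 - M.trace * μ + 1 := by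
    rw [det_fin_two] at hM
    simp [det_fin_two, trace_fin_two]
    linear_combination hM
  rw [← hdet, ← exists_mulVec_eq_zero_iff]
  simp only [sub_mulVec, smul_mulVec, one_mulVec, sub_eq_zero]

/-- The trace of a `2 × 2` matrix of determinant one in terms of an eigenvalue. -/
lemma ne_zero_and_trace_eq_of_mulVec_eq_smul {K : Type*} [Field K]
    {M : Matrix (Fin 2) (Fin 2) K} (hM : M.det = 1) {μ : K}
    {v : Fin 2 → K} (hv : v ≠ 0) (h : M *ᵥ v = μ • v) :
    μ ≠ 0 ∧ M.trace = μ + μ⁻¹ := by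
  have hq := (exists_mulVec_eq_smul_iff hM μ).1 ⟨v, hv, h⟩
  have hμ : μ ≠ 0 := by rintro rfl; simp at hq
  refine ⟨hμ, ?_⟩
  field_simp
  linear_combination -hq

lemma exists_eq_smul_of_cross_eq_zero {K : Type*} [Field K] {v w : Fin 2 → K} (hv : v ≠ 0)
    (h : v 0 * w 1 - w 0 * v 1 = 0) : ∃ t : K, w = t • v := by
  by_cases h0 : v 0 = 0
  · have h1 : v 1 ≠ 0 := fun h1 => hv (by ext i; fin_cases i <;> simp [h0, h1])
    refine ⟨w 1 / v 1, ?_⟩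
    ext i
    fin_cases i
    · simpa [h0, h1] using h
    · simp [h1]
  · refine ⟨w 0 / v 0, ?_⟩
    ext i
    fin_cases i
    · simp [h0]
    · simp only [Fin.mk_one, Pi.smul_apply, smul_eq_mul]
      field_simp
      linear_combination h

/-- A common eigenvector of `A` and `B` forces the trace relation of a reducible pair. -/
lemma trace_relation_of_common_eigenvector {K : Type*} [Field K]
    {A B : Matrix (Fin 2) (Fin 2) K} (hdA : A.det = 1) (hdB : B.det = 1) {s t : K}
    {v : Fin 2 → K} (hv : v ≠ 0) (hA : A *ᵥ v = s • v) (hB : B *ᵥ v = t • v) :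
    A.trace ^ 2 + B.trace ^ 2 + (A * B).trace ^ 2 - A.trace * B.trace * (A * B).trace = 4 := by
  have hAB : (A * B) *ᵥ v = (t * s) • v := by
    rw [← mulVec_mulVec, hB, mulVec_smul, hA, smul_smul]
  obtain ⟨hs, hsA⟩ := ne_zero_and_trace_eq_of_mulVec_eq_smul hdA hv hA
  obtain ⟨ht, htB⟩ := ne_zero_and_trace_eq_of_mulVec_eq_smul hdB hv hB
  rw [hsA, htB, (ne_zero_and_trace_eq_of_mulVec_eq_smul (by rw [det_mul, hdA, hdB, one_mul])
    hv hAB).2]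
  field_simp
  ring

/-- Over an algebraically closed field, an irreducible pair of matrices of determinant one is
intertwined with its normal form by a matrix of determinant one. Its columns are proportional to
an eigenvector `v` of `A * B` and to `-A⁻¹ v`. -/
lemma exists_intertwiner_normal_form {K : Type*} [Field K] [IsAlgClosed K]
    {A B : Matrix (Fin 2) (Fin 2) K} (hdA : A.det = 1) (hdB : B.det = 1)
    (hirr : A.trace ^ 2 + B.trace ^ 2 + (A * B).trace ^ 2 -
      A.trace * B.trace * (A * B).trace ≠ 4)
    {γ : K} (hγ : γ ≠ 0) (hγc : γ + γ⁻¹ = (A * B).trace) :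
    ∃ P : Matrix (Fin 2) (Fin 2) K, P.det = 1 ∧ A * P = P * !![A.trace, -1; 1, 0] ∧
      B * P = P * !![0, γ⁻¹; -γ, B.trace] := by
  obtain ⟨v, hv, hABv⟩ := (exists_mulVec_eq_smul_iff
    (show (A * B).det = 1 by rw [det_mul, hdA, hdB, one_mul]) γ).2 (by
      rw [← hγc]; field_simp; ring)
  obtain ⟨w, hw⟩ : ∃ w, w = -(A.adjugate *ᵥ v) := ⟨_, rfl⟩
  have hAw : A *ᵥ w = -v := by
    rw [hw, mulVec_neg, mulVec_mulVec, mul_adjugate, hdA, one_smul, one_mulVec]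
  have hBv : B *ᵥ v = -γ • w := by
    rw [hw, smul_neg, neg_smul, neg_neg, ← mulVec_smul, ← hABv, mulVec_mulVec, ← mul_assoc,
      adjugate_mul, hdA, one_smul, one_mul]
  have hd : v 0 * w 1 - w 0 * v 1 ≠ 0 := by
    intro h
    obtain ⟨t, ht⟩ := exists_eq_smul_of_cross_eq_zero hv h
    rw [ht, mulVec_smul] at hAw
    have ht0 : t ≠ 0 := by
      rintro rfl
      rw [zero_smul] at hAw
      exact hv (neg_eq_zero.1 hAw.symm)
    have hAv : A *ᵥ v = (-t⁻¹) • v := by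
      rw [neg_smul, ← smul_neg, ← hAw, smul_smul, inv_mul_cancel₀ ht0, one_smul]
    rw [ht, smul_smul] at hBv
    exact hirr (trace_relation_of_common_eigenvector hdA hdB hv hAv hBv)
  obtain ⟨d, hdd⟩ := IsAlgClosed.exists_pow_nat_eq (v 0 * w 1 - w 0 * v 1) two_pos
  have hd0 : d ≠ 0 := by
    rintro rfl
    exact hd (by simpa using hdd.symm)
  have hA0 := congrFun hAw 0
  have hA1 := congrFun hAw 1
  have hB0 := congrFun hBv 0
  have hB1 := congrFun hBv 1
  simp only [mulVec, dotProduct, Fin.sum_univ_two, Pi.neg_apply, Pi.smul_apply,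
    smul_eq_mul] at hA0 hA1 hB0 hB1
  rw [det_fin_two] at hdA hdB
  rw [trace_fin_two, trace_fin_two]
  refine ⟨!![v 0 / d, w 0 / d; v 1 / d, w 1 / d], ?_, ?_, ?_⟩
  · rw [det_fin_two_of]
    field_simp
    linear_combination -hdd
  · ext i j
    fin_cases i <;> fin_cases j <;> simp [Matrix.mul_apply, Fin.sum_univ_two] <;> field_simp
    · linear_combination A 0 1 * hA1 - A 1 1 * hA0 + w 0 * hdA
    · linear_combination hA0
    · linear_combination A 1 0 * hA0 - A 0 0 * hA1 + w 1 * hdA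
    · linear_combination hA1
  · ext i j
    fin_cases i <;> fin_cases j <;> simp [Matrix.mul_apply, Fin.sum_univ_two] <;> field_simp
    · linear_combination hB0
    · linear_combination B 0 1 * hB1 - B 1 1 * hB0 + v 0 * hdB
    · linear_combination hB1
    · linear_combination B 1 0 * hB0 - B 0 0 * hB1 + v 1 * hdB

theorem irreducible_pair_normal_form (A B : SL(2, ℂ))
    (a b c : ℂ)
    (ha : a = Matrix.trace (A : Matrix (Fin 2) (Fin 2) ℂ))
    (hb : b = Matrix.trace (B : Matrix (Fin 2) (Fin 2) ℂ))
    (hc : c = Matrix.trace ((A * B : SL(2, ℂ)) : Matrix (Fin 2) (Fin 2) ℂ))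
    (hirr : a ^ 2 + b ^ 2 + c ^ 2 - a * b * c ≠ 4)
    (γ : ℂ) (hγ : γ ≠ 0) (hγc : γ + γ⁻¹ = c) :
    ∃ P : SL(2, ℂ),
      ((P⁻¹ * A * P : SL(2, ℂ)) : Matrix (Fin 2) (Fin 2) ℂ) = !![a, -1; 1, 0] ∧
      ((P⁻¹ * B * P : SL(2, ℂ)) : Matrix (Fin 2) (Fin 2) ℂ) = !![0, γ⁻¹; -γ, b] := by
  subst ha hb hc
  obtain ⟨P, hP, hPA, hPB⟩ := exists_intertwiner_normal_form A.2 B.2 hirr hγ hγc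
  refine ⟨⟨P, hP⟩, ?_, ?_⟩
  · change P.adjugate * A.1 * P = _
    rw [mul_assoc, hPA, ← mul_assoc, adjugate_mul, hP, one_smul, one_mul]
  · change P.adjugate * B.1 * P = _
    rw [mul_assoc, hPB, ← mul_assoc, adjugate_mul, hP, one_smul, one_mul]
end

section
/- Let (A,B) and (A',B') be pairs of elements of SL(2,ℂ), with (A,B) irreducible, and suppose tr(A) = tr(A'), tr(B) = tr(B'), and tr(AB) = tr(A'B'). Then there exists P ∈ SL(2,ℂ) with P⁻¹AP = A' and P⁻¹BP = B'. In other words, an irreducible pair in SL(2,ℂ) is determined up to simultaneous SL(2,ℂ)-conjugacy by its trace triple (tr(A), tr(B), tr(AB)). -/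
/-!
STATEMENT 3: An irreducible pair (A,B) in SL(2,ℂ) is determined up to simultaneous
SL(2,ℂ)-conjugacy by its trace triple (tr A, tr B, tr AB): if (A',B') is another pair with the
same trace triple, then there is P ∈ SL(2,ℂ) with P⁻¹AP = A' and P⁻¹BP = B'.
-/

open Matrix
open scoped MatrixGroups

/-- A pair `(A,B)` is irreducible if it admits no common eigenvector. -/
def IsIrreduciblePair (A B : SL(2, ℂ)) : Prop := ¬ HasCommonEigenvector A B

/-- An eigenvalue of a matrix in `SL(2, ℂ)` is a root of its characteristic polynomial. -/
lemma eigenvalue_sq_add_one (A : SL(2, ℂ)) {v : Fin 2 → ℂ} (hv : v ≠ 0) {l : ℂ}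
    (h : (A : Matrix (Fin 2) (Fin 2) ℂ) *ᵥ v = l • v) :
    l * l + 1 = Matrix.trace (A : Matrix (Fin 2) (Fin 2) ℂ) * l := by
  have h0 : ((A : Matrix (Fin 2) (Fin 2) ℂ) - Matrix.scalar (Fin 2) l).det = 0 :=
    Matrix.exists_mulVec_eq_zero_iff.mp ⟨v, hv, by
      rw [Matrix.sub_mulVec, h]
      simp⟩
  have hA := A.det_coe
  simp only [Matrix.det_fin_two, Matrix.trace_fin_two, Matrix.sub_apply, Matrix.scalar_apply,
    Matrix.diagonal_apply_eq, Matrix.diagonal_apply_ne _ zero_ne_one,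
    Matrix.diagonal_apply_ne _ one_ne_zero] at h0 hA ⊢
  linear_combination h0 - hA

/-- A root of the characteristic polynomial of a matrix in `SL(2, ℂ)` is an eigenvalue. -/
lemma exists_eigenvector_of_sq_add_one (A : SL(2, ℂ)) {l : ℂ}
    (h : l * l + 1 = Matrix.trace (A : Matrix (Fin 2) (Fin 2) ℂ) * l) :
    ∃ v : Fin 2 → ℂ, v ≠ 0 ∧ (A : Matrix (Fin 2) (Fin 2) ℂ) *ᵥ v = l • v := by
  have h0 : ((A : Matrix (Fin 2) (Fin 2) ℂ) - Matrix.scalar (Fin 2) l).det = 0 := by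
    have hA := A.det_coe
    simp only [Matrix.det_fin_two, Matrix.trace_fin_two, Matrix.sub_apply, Matrix.scalar_apply,
      Matrix.diagonal_apply_eq, Matrix.diagonal_apply_ne _ zero_ne_one,
      Matrix.diagonal_apply_ne _ one_ne_zero] at h hA ⊢
    linear_combination h + hA
  obtain ⟨v, hv, hker⟩ := Matrix.exists_mulVec_eq_zero_iff.mpr h0
  refine ⟨v, hv, ?_⟩
  rw [Matrix.sub_mulVec, sub_eq_zero] at hker
  simpa using hker

/-- In the basis `(u, B u)`, with `u` an eigenvector of `A` for the eigenvalue `l`, an irreducible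
pair takes a form which depends only on `l` and the trace triple. -/
lemma IsIrreduciblePair.exists_normal_form {A B : SL(2, ℂ)} (hirr : IsIrreduciblePair A B) {l : ℂ}
    (hl : l * l + 1 = Matrix.trace (A : Matrix (Fin 2) (Fin 2) ℂ) * l) :
    ∃ Q : Matrix (Fin 2) (Fin 2) ℂ, Q.det ≠ 0 ∧
      (A : Matrix (Fin 2) (Fin 2) ℂ) * Q =
        Q * !![l, Matrix.trace ((A * B : SL(2, ℂ)) : Matrix (Fin 2) (Fin 2) ℂ) -
            Matrix.trace (B : Matrix (Fin 2) (Fin 2) ℂ) *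
              (Matrix.trace (A : Matrix (Fin 2) (Fin 2) ℂ) - l);
          0, Matrix.trace (A : Matrix (Fin 2) (Fin 2) ℂ) - l] ∧
      (B : Matrix (Fin 2) (Fin 2) ℂ) * Q =
        Q * !![0, -1; 1, Matrix.trace (B : Matrix (Fin 2) (Fin 2) ℂ)] := by
  obtain ⟨u, hu, hAu⟩ := exists_eigenvector_of_sq_add_one A hl
  have hB := B.det_coe
  have e0 := congrFun hAu 0
  have e1 := congrFun hAu 1
  refine ⟨!![u 0, B 0 0 * u 0 + B 0 1 * u 1; u 1, B 1 0 * u 0 + B 1 1 * u 1], ?_, ?_, ?_⟩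
  · intro hdet
    rw [Matrix.det_fin_two_of] at hdet
    refine hirr ⟨u, hu, ⟨l, hAu⟩, ?_⟩
    by_cases h0 : u 0 = 0
    · have h1 : u 1 ≠ 0 := fun h1 => hu (by ext i; fin_cases i <;> assumption)
      refine ⟨(B 1 0 * u 0 + B 1 1 * u 1) / u 1, ?_⟩
      ext i
      fin_cases i <;> simp [Matrix.mulVec, dotProduct, Fin.sum_univ_two] <;> field_simp
      linear_combination -hdet
    · refine ⟨(B 0 0 * u 0 + B 0 1 * u 1) / u 0, ?_⟩
      ext i
      fin_cases i <;> simp [Matrix.mulVec, dotProduct, Fin.sum_univ_two] <;> field_simp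
      linear_combination hdet
  · simp only [Matrix.mulVec, dotProduct, Fin.sum_univ_two, Pi.smul_apply, smul_eq_mul] at e0 e1
    ext i j
    fin_cases i <;> fin_cases j <;>
      simp [Matrix.mul_apply, Fin.sum_univ_two, Matrix.trace_fin_two]
    · linear_combination e0
    · linear_combination B 1 1 * e0 - B 0 1 * e1
    · linear_combination e1
    · linear_combination B 0 0 * e1 - B 1 0 * e0
  · rw [Matrix.det_fin_two] at hB
    ext i j
    fin_cases i <;> fin_cases j <;>
      simp [Matrix.mul_apply, Fin.sum_univ_two, Matrix.trace_fin_two]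
    · linear_combination -u 0 * hB
    · linear_combination -u 1 * hB

/-- Irreducibility of a pair depends only on its trace triple. -/
lemma IsIrreduciblePair.of_trace_eq {A B A' B' : SL(2, ℂ)} (hirr : IsIrreduciblePair A B)
    (ha : Matrix.trace (A : Matrix (Fin 2) (Fin 2) ℂ)
        = Matrix.trace (A' : Matrix (Fin 2) (Fin 2) ℂ))
    (hb : Matrix.trace (B : Matrix (Fin 2) (Fin 2) ℂ)
        = Matrix.trace (B' : Matrix (Fin 2) (Fin 2) ℂ))
    (hc : Matrix.trace ((A * B : SL(2, ℂ)) : Matrix (Fin 2) (Fin 2) ℂ)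
        = Matrix.trace ((A' * B' : SL(2, ℂ)) : Matrix (Fin 2) (Fin 2) ℂ)) :
    IsIrreduciblePair A' B' := by
  rintro ⟨v, hv, ⟨l, hl⟩, ⟨m, hm⟩⟩
  have hlm : ((A' * B' : SL(2, ℂ)) : Matrix (Fin 2) (Fin 2) ℂ) *ᵥ v = (l * m) • v := by
    rw [Matrix.SpecialLinearGroup.coe_mul, ← Matrix.mulVec_mulVec, hm, Matrix.mulVec_smul, hl,
      smul_smul, mul_comm]
  have hl' := eigenvalue_sq_add_one A' hv hl
  have hm' := eigenvalue_sq_add_one B' hv hm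
  have hlm' := eigenvalue_sq_add_one _ hv hlm
  rw [← ha] at hl'
  rw [← hb] at hm'
  rw [← hc] at hlm'
  obtain ⟨Q, hQ, hAQ, hBQ⟩ := hirr.exists_normal_form hl'
  generalize Matrix.trace (A : Matrix (Fin 2) (Fin 2) ℂ) = x at *
  generalize Matrix.trace (B : Matrix (Fin 2) (Fin 2) ℂ) = y at *
  generalize Matrix.trace ((A * B : SL(2, ℂ)) : Matrix (Fin 2) (Fin 2) ℂ) = z at *
  have hl0 : l ≠ 0 := by rintro rfl; simp at hl'
  have hm0 : m ≠ 0 := by rintro rfl; simp at hm'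
  have hz : z = l * m + (x - l) * (y - m) := by
    apply mul_left_cancel₀ (mul_ne_zero hl0 hm0)
    linear_combination -hlm' + m * (y - m) * hl' + hm'
  refine hirr ⟨Q *ᵥ ![-m, 1], fun h => ?_, ⟨x - l, ?_⟩, ⟨y - m, ?_⟩⟩
  · simpa using congrFun (Matrix.eq_zero_of_mulVec_eq_zero hQ h) 1
  · rw [Matrix.mulVec_mulVec, hAQ, ← Matrix.mulVec_mulVec, ← Matrix.mulVec_smul]
    congr 1
    ext i
    fin_cases i <;> simp
    linear_combination hz
  · rw [Matrix.mulVec_mulVec, hBQ, ← Matrix.mulVec_mulVec, ← Matrix.mulVec_smul]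
    congr 1
    ext i
    fin_cases i <;> simp
    · linear_combination hm'
    · ring

/-- Two pairs in `SL(2, ℂ)` that are conjugate under `GL(2, ℂ)` to the same pair of matrices
are conjugate under `SL(2, ℂ)`. -/
lemma exists_conj_of_common_form {A B A' B' : SL(2, ℂ)} {Q Q' M N : Matrix (Fin 2) (Fin 2) ℂ}
    (hQ : Q.det ≠ 0) (hQ' : Q'.det ≠ 0)
    (hA : (A : Matrix (Fin 2) (Fin 2) ℂ) * Q = Q * M)
    (hB : (B : Matrix (Fin 2) (Fin 2) ℂ) * Q = Q * N)
    (hA' : (A' : Matrix (Fin 2) (Fin 2) ℂ) * Q' = Q' * M)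
    (hB' : (B' : Matrix (Fin 2) (Fin 2) ℂ) * Q' = Q' * N) :
    ∃ P : SL(2, ℂ), P⁻¹ * A * P = A' ∧ P⁻¹ * B * P = B' := by
  obtain ⟨s, hs⟩ := IsAlgClosed.exists_pow_nat_eq (Q.det⁻¹ * Q'.det) zero_lt_two
  have hu : IsUnit Q'.det := hQ'.isUnit
  have conj {X X' L : Matrix (Fin 2) (Fin 2) ℂ} (h : X * Q = Q * L) (h' : X' * Q' = Q' * L) :
      X * (s • (Q * Q'⁻¹)) = s • (Q * Q'⁻¹) * X' := by
    have hL : L * Q'⁻¹ = Q'⁻¹ * X' := by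
      rw [← Matrix.nonsing_inv_mul_cancel_left Q' L hu, ← h', Matrix.mul_assoc,
        Matrix.mul_nonsing_inv_cancel_right Q' X' hu]
    rw [Matrix.mul_smul, Matrix.smul_mul, ← Matrix.mul_assoc, h, Matrix.mul_assoc, hL,
      Matrix.mul_assoc]
  have hdet : (s • (Q * Q'⁻¹)).det = 1 := by
    rw [Matrix.det_smul, Matrix.det_mul, Matrix.det_nonsing_inv, Ring.inverse_eq_inv',
      Fintype.card_fin, hs]
    field_simp
  obtain ⟨P, hP⟩ : ∃ P : SL(2, ℂ), (P : Matrix (Fin 2) (Fin 2) ℂ) = s • (Q * Q'⁻¹) :=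
    ⟨⟨_, hdet⟩, rfl⟩
  simp only [← hP] at conj
  refine ⟨P, ?_, ?_⟩
  · rw [mul_assoc, inv_mul_eq_iff_eq_mul]
    exact Subtype.ext (conj hA hA')
  · rw [mul_assoc, inv_mul_eq_iff_eq_mul]
    exact Subtype.ext (conj hB hB')

theorem irreducible_pair_determined_by_traces (A B A' B' : SL(2, ℂ))
    (hirr : IsIrreduciblePair A B)
    (ha : Matrix.trace (A : Matrix (Fin 2) (Fin 2) ℂ)
        = Matrix.trace (A' : Matrix (Fin 2) (Fin 2) ℂ))
    (hb : Matrix.trace (B : Matrix (Fin 2) (Fin 2) ℂ)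
        = Matrix.trace (B' : Matrix (Fin 2) (Fin 2) ℂ))
    (hc : Matrix.trace ((A * B : SL(2, ℂ)) : Matrix (Fin 2) (Fin 2) ℂ)
        = Matrix.trace ((A' * B' : SL(2, ℂ)) : Matrix (Fin 2) (Fin 2) ℂ)) :
    ∃ P : SL(2, ℂ), P⁻¹ * A * P = A' ∧ P⁻¹ * B * P = B' := by
  obtain ⟨l, hl⟩ := IsAlgClosed.exists_eq_mul_self
    (Matrix.trace (A : Matrix (Fin 2) (Fin 2) ℂ) ^ 2 - 4)
  have hroot : (Matrix.trace (A : Matrix (Fin 2) (Fin 2) ℂ) + l) / 2 *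
      ((Matrix.trace (A : Matrix (Fin 2) (Fin 2) ℂ) + l) / 2) + 1 =
      Matrix.trace (A : Matrix (Fin 2) (Fin 2) ℂ) *
        ((Matrix.trace (A : Matrix (Fin 2) (Fin 2) ℂ) + l) / 2) := by
    linear_combination -hl / 4
  obtain ⟨Q, hQ, hAQ, hBQ⟩ := hirr.exists_normal_form hroot
  obtain ⟨Q', hQ', hAQ', hBQ'⟩ :=
    (hirr.of_trace_eq ha hb hc).exists_normal_form (by rwa [ha] at hroot)
  rw [← ha, ← hb, ← hc] at hAQ'
  rw [← hb] at hBQ'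
  exact exists_conj_of_common_form hQ hQ' hAQ hBQ hAQ' hBQ'
end

section
/- Let (A,B) be an irreducible pair of elements of SL(2,ℂ). Then there exists M ∈ SL(2,ℂ) with tr(M) = 0 such that M⁻¹AM = A⁻¹ and M⁻¹BM = B⁻¹. -/
/-!
STATEMENT 4: For an irreducible pair (A,B) in SL(2,ℂ), there exists M ∈ SL(2,ℂ) with
tr(M) = 0 such that M⁻¹AM = A⁻¹ and M⁻¹BM = B⁻¹.
-/

open Matrix
open scoped MatrixGroups

/-- A `2 × 2` matrix intertwines its commutator with any matrix and its adjugate. -/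
theorem mul_commutator_eq_commutator_mul_adjugate {R : Type*} [CommRing R]
    (A B : Matrix (Fin 2) (Fin 2) R) :
    A * (A * B - B * A) = (A * B - B * A) * A.adjugate := by
  rw [Matrix.adjugate_fin_two]
  ext i j
  fin_cases i <;> fin_cases j <;> simp [Matrix.mul_apply, Fin.sum_univ_two] <;> ring

/-- The kernel of a nonzero `2 × 2` matrix over a field is at most one-dimensional. -/
theorem exists_eq_smul_of_mulVec_eq_zero {K : Type*} [Field K] {N : Matrix (Fin 2) (Fin 2) K}
    (hN : N ≠ 0) {v w : Fin 2 → K} (hv : v ≠ 0) (hNv : N *ᵥ v = 0) (hNw : N *ᵥ w = 0) :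
    ∃ μ : K, w = μ • v := by
  have hdep : v 0 * w 1 - v 1 * w 0 = 0 := by
    by_contra hne
    refine hN ?_
    have key : ∀ i, N i 0 = 0 ∧ N i 1 = 0 := by
      intro i
      have h1 : N i 0 * v 0 + N i 1 * v 1 = 0 := by
        simpa [Matrix.mulVec, dotProduct, Fin.sum_univ_two] using congrFun hNv i
      have h2 : N i 0 * w 0 + N i 1 * w 1 = 0 := by
        simpa [Matrix.mulVec, dotProduct, Fin.sum_univ_two] using congrFun hNw i
      constructor
      · refine (mul_eq_zero.mp ?_).resolve_right hne
        linear_combination w 1 * h1 - v 1 * h2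
      · refine (mul_eq_zero.mp ?_).resolve_right hne
        linear_combination v 0 * h2 - w 0 * h1
    ext i j
    fin_cases j
    · exact (key i).1
    · exact (key i).2
  by_cases h0 : v 0 = 0
  · have h1 : v 1 ≠ 0 := fun h1 => hv (by ext i; fin_cases i <;> simp [h0, h1])
    have hw : w 0 = 0 := by
      refine (mul_eq_zero.mp ?_).resolve_left h1
      linear_combination w 1 * h0 - hdep
    refine ⟨w 1 / v 1, ?_⟩
    ext i
    fin_cases i <;> simp [h0, hw, h1]
  · refine ⟨w 0 / v 0, ?_⟩
    ext i
    fin_cases i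
    · simp [h0]
    · simp only [Fin.mk_one, Pi.smul_apply, smul_eq_mul]
      field_simp
      linear_combination hdep

/-- Over an algebraically closed field every `2 × 2` matrix has an eigenvector. -/
theorem exists_mulVec_eq_smul {K : Type*} [Field K] [IsAlgClosed K]
    (A : Matrix (Fin 2) (Fin 2) K) : ∃ (μ : K) (v : Fin 2 → K), v ≠ 0 ∧ A *ᵥ v = μ • v := by
  obtain ⟨μ, hμ⟩ := Module.End.exists_eigenvalue (Matrix.toLin' A)
  obtain ⟨v, hv⟩ := hμ.exists_hasEigenvector
  exact ⟨μ, v, hv.2, by simpa using hv.apply_eq_smul⟩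

/-- Commuting `2 × 2` matrices over an algebraically closed field share an eigenvector. -/
theorem exists_common_eigenvector_of_commute {K : Type*} [Field K] [IsAlgClosed K]
    {A B : Matrix (Fin 2) (Fin 2) K} (h : A * B = B * A) :
    ∃ v : Fin 2 → K, v ≠ 0 ∧ (∃ μ : K, A *ᵥ v = μ • v) ∧ ∃ ν : K, B *ᵥ v = ν • v := by
  obtain ⟨μ, v, hv, hAv⟩ := exists_mulVec_eq_smul A
  by_cases hN : A - μ • (1 : Matrix (Fin 2) (Fin 2) K) = 0
  · obtain ⟨ν, w, hw, hBw⟩ := exists_mulVec_eq_smul B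
    refine ⟨w, hw, ⟨μ, ?_⟩, ν, hBw⟩
    rw [sub_eq_zero.mp hN, Matrix.smul_mulVec, Matrix.one_mulVec]
  · refine ⟨v, hv, ⟨μ, hAv⟩, exists_eq_smul_of_mulVec_eq_zero hN hv ?_ ?_⟩
    · rw [Matrix.sub_mulVec, Matrix.smul_mulVec, Matrix.one_mulVec, hAv, sub_self]
    · rw [Matrix.sub_mulVec, Matrix.smul_mulVec, Matrix.one_mulVec, Matrix.mulVec_mulVec, h,
        ← Matrix.mulVec_mulVec, hAv, Matrix.mulVec_smul, sub_self]

/-- If the commutator of two `2 × 2` matrices is singular, they share an eigenvector. -/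
theorem exists_common_eigenvector_of_det_commutator_eq_zero {K : Type*} [Field K]
    [IsAlgClosed K] {A B : Matrix (Fin 2) (Fin 2) K} (h : (A * B - B * A).det = 0) :
    ∃ v : Fin 2 → K, v ≠ 0 ∧ (∃ μ : K, A *ᵥ v = μ • v) ∧ ∃ ν : K, B *ᵥ v = ν • v := by
  by_cases hC : A * B - B * A = 0
  · exact exists_common_eigenvector_of_commute (sub_eq_zero.mp hC)
  obtain ⟨v, hv, hCv⟩ := Matrix.exists_mulVec_eq_zero_iff.mpr h
  have hadj : ∀ X : Matrix (Fin 2) (Fin 2) K,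
      X * (A * B - B * A) = (A * B - B * A) * X.adjugate → ∃ μ : K, X *ᵥ v = μ • v := by
    intro X hX
    obtain ⟨μ, hμ⟩ := exists_eq_smul_of_mulVec_eq_zero hC hv hCv
      (w := X.adjugate *ᵥ v) (by
        rw [Matrix.mulVec_mulVec, ← hX, ← Matrix.mulVec_mulVec, hCv, Matrix.mulVec_zero])
    refine ⟨X.trace - μ, ?_⟩
    have hsum : X = X.trace • (1 : Matrix (Fin 2) (Fin 2) K) - X.adjugate := by
      rw [Matrix.adjugate_fin_two, Matrix.trace_fin_two]
      ext i j
      fin_cases i <;> fin_cases j <;> simp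
    calc X *ᵥ v = (X.trace • (1 : Matrix (Fin 2) (Fin 2) K) - X.adjugate) *ᵥ v := by rw [← hsum]
      _ = (X.trace - μ) • v := by
        rw [Matrix.sub_mulVec, Matrix.smul_mulVec, Matrix.one_mulVec, hμ, sub_smul]
  refine ⟨v, hv, hadj A (mul_commutator_eq_commutator_mul_adjugate A B), hadj B ?_⟩
  rw [← neg_sub, mul_neg, neg_mul, mul_commutator_eq_commutator_mul_adjugate]

theorem irreducible_pair_simultaneous_inversion (A B : SL(2, ℂ))
    (hirr : IsIrreduciblePair A B) :
    ∃ M : SL(2, ℂ), Matrix.trace (M : Matrix (Fin 2) (Fin 2) ℂ) = 0 ∧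
      M⁻¹ * A * M = A⁻¹ ∧ M⁻¹ * B * M = B⁻¹ := by
  have hdet : ((A : Matrix (Fin 2) (Fin 2) ℂ) * B - B * A).det ≠ 0 := fun h =>
    hirr (exists_common_eigenvector_of_det_commutator_eq_zero h)
  obtain ⟨c, hc⟩ := IsAlgClosed.exists_pow_nat_eq
    ((A : Matrix (Fin 2) (Fin 2) ℂ) * B - B * A).det⁻¹ (n := 2) two_pos
  let M : SL(2, ℂ) := ⟨c • ((A : Matrix (Fin 2) (Fin 2) ℂ) * B - B * A), by
    rw [Matrix.det_smul, Fintype.card_fin, hc, inv_mul_cancel₀ hdet]⟩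
  have hM : (M : Matrix (Fin 2) (Fin 2) ℂ) = c • ((A : Matrix (Fin 2) (Fin 2) ℂ) * B - B * A) :=
    rfl
  refine ⟨M, ?_, ?_, ?_⟩
  · rw [hM, Matrix.trace_smul, Matrix.trace_sub, Matrix.trace_mul_comm, sub_self, smul_zero]
  · rw [mul_assoc, inv_mul_eq_iff_eq_mul]
    apply Subtype.ext
    rw [Matrix.SpecialLinearGroup.coe_mul, Matrix.SpecialLinearGroup.coe_mul,
      Matrix.SpecialLinearGroup.coe_inv, hM, Matrix.mul_smul, Matrix.smul_mul,
      mul_commutator_eq_commutator_mul_adjugate]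
  · rw [mul_assoc, inv_mul_eq_iff_eq_mul]
    apply Subtype.ext
    rw [Matrix.SpecialLinearGroup.coe_mul, Matrix.SpecialLinearGroup.coe_mul,
      Matrix.SpecialLinearGroup.coe_inv, hM, Matrix.mul_smul, Matrix.smul_mul,
      ← neg_sub, mul_neg, neg_mul, mul_commutator_eq_commutator_mul_adjugate]
end

section
/- Let A, B ∈ SL(2,ℂ) commute: AB = BA. Then there exists M ∈ SL(2,ℂ) such that M⁻¹AM = A⁻¹ and M⁻¹BM = B⁻¹. -/
/-!
STATEMENT 6: If A, B ∈ SL(2,ℂ) commute, then there exists M ∈ SL(2,ℂ) with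
M⁻¹AM = A⁻¹ and M⁻¹BM = B⁻¹.
-/

open Matrix
open scoped MatrixGroups

/-- Vectors `(a, b, c)` and `(a', b', c')` satisfying the proportionality relations
that involve the first coordinate admit a common orthogonal vector
`(p, r, q)` for which the traceless matrix `!![p, q; r, -p]` has determinant one. -/
lemma exists_common_orthogonal_of_parallel {a b c a' b' c' : ℂ}
    (hab : a * b' = a' * b) (hac : a * c' = a' * c) :
    ∃ p q r : ℂ, -p ^ 2 - q * r = 1 ∧
      a * p + b * r + c * q = 0 ∧ a' * p + b' * r + c' * q = 0 := by
  by_cases hb : b = 0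
  · by_cases hb' : b' = 0
    · by_cases hc : c = 0
      · by_cases hc' : c' = 0
        · exact ⟨0, 1, -1, by norm_num, by simp [hb, hc], by simp [hb', hc']⟩
        · refine ⟨Complex.I, -a' * Complex.I / c', 0, by simp, ?_, ?_⟩ <;> field_simp <;> grind
      · refine ⟨Complex.I, -a * Complex.I / c, 0, by simp, ?_, ?_⟩ <;> field_simp <;> grind
    · refine ⟨Complex.I, 0, -a' * Complex.I / b', by simp, ?_, ?_⟩ <;> field_simp <;> grind
  · refine ⟨Complex.I, 0, -a * Complex.I / b, by simp, ?_, ?_⟩ <;> field_simp <;> grind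

/-- A traceless `M` in `SL(2, ℂ)` that is trace-orthogonal to `A` conjugates `A` to `A⁻¹`. -/
lemma inv_mul_mul_eq_inv_of_traceless {A M : SL(2, ℂ)} (htr : M 1 1 = -M 0 0)
    (h : (A 0 0 - A 1 1) * M 0 0 + A 0 1 * M 1 0 + A 1 0 * M 0 1 = 0) :
    M⁻¹ * A * M = A⁻¹ := by
  rw [mul_assoc, inv_mul_eq_iff_eq_mul]
  ext i j
  fin_cases i <;> fin_cases j <;>
    simp [Matrix.mul_apply, Fin.sum_univ_two, adjugate_fin_two, htr] <;>
    grind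

theorem commuting_pair_simultaneous_inversion (A B : SL(2, ℂ))
    (hcomm : A * B = B * A) :
    ∃ M : SL(2, ℂ), M⁻¹ * A * M = A⁻¹ ∧ M⁻¹ * B * M = B⁻¹ := by
  have entry (i j : Fin 2) : A i 0 * B 0 j + A i 1 * B 1 j = B i 0 * A 0 j + B i 1 * A 1 j := by
    simpa [Matrix.mul_apply, Fin.sum_univ_two] using congrArg (fun X : SL(2, ℂ) => X i j) hcomm
  obtain ⟨p, q, r, hdet, hA, hB⟩ := exists_common_orthogonal_of_parallel
    (a := A 0 0 - A 1 1) (b := A 0 1) (c := A 1 0)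
    (a' := B 0 0 - B 1 1) (b' := B 0 1) (c' := B 1 0)
    (by linear_combination entry 0 1) (by linear_combination -entry 1 0)
  let M : SL(2, ℂ) := ⟨!![p, q; r, -p], by rw [det_fin_two_of]; linear_combination hdet⟩
  exact ⟨M, inv_mul_mul_eq_inv_of_traceless rfl hA, inv_mul_mul_eq_inv_of_traceless rfl hB⟩
end

section
/- Let A, B ∈ SL(2,ℂ) have a common eigenvector in ℂ², and suppose there exists M ∈ SL(2,ℂ) with M⁻¹AM = A⁻¹ and M⁻¹BM = B⁻¹. Then A and B commute: AB = BA. Combined with the existence statements, this says that a simultaneous SL(2,ℂ)-conjugacy class of pairs (A,B) is stabilized by the inversion involution (A,B) ↦ (A⁻¹,B⁻¹) if and only if the pair is either irreducible or abelian. -/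
/-!
STATEMENT 7: If A, B ∈ SL(2,ℂ) have a common eigenvector in ℂ² and there exists M ∈ SL(2,ℂ)
with M⁻¹AM = A⁻¹ and M⁻¹BM = B⁻¹, then A and B commute.
-/

open Matrix
open scoped MatrixGroups

namespace Matrix

variable {K : Type*} [Field K]

/-- Two trace-zero `2 × 2` matrices with a common kernel vector commute. -/
theorem commute_of_trace_eq_zero_of_mulVec_eq_zero {P Q : Matrix (Fin 2) (Fin 2) K}
    {v : Fin 2 → K} (hv : v ≠ 0) (hP : P *ᵥ v = 0) (hQ : Q *ᵥ v = 0)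
    (hPt : P.trace = 0) (hQt : Q.trace = 0) : P * Q = Q * P := by
  have hP₀ := congrFun hP 0
  have hP₁ := congrFun hP 1
  have hQ₀ := congrFun hQ 0
  have hQ₁ := congrFun hQ 1
  simp only [mulVec, dotProduct, Fin.sum_univ_two, Pi.zero_apply] at hP₀ hP₁ hQ₀ hQ₁
  rw [trace_fin_two] at hPt hQt
  have hxy : v 0 ≠ 0 ∨ v 1 ≠ 0 := by
    by_contra! h
    exact hv (funext fun i => by fin_cases i <;> simp [h])
  ext i j
  fin_cases i <;> fin_cases j <;> simp only [mul_apply, Fin.sum_univ_two, Fin.zero_eta,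
    Fin.mk_one] <;> rcases hxy with h | h <;> grind

/-- A `2 × 2` matrix killing two linearly independent vectors is zero. -/
theorem eq_zero_of_mulVec_eq_zero_of_det_ne_zero {C : Matrix (Fin 2) (Fin 2) K}
    {v w : Fin 2 → K} (hv : C *ᵥ v = 0) (hw : C *ᵥ w = 0)
    (h : v 0 * w 1 - v 1 * w 0 ≠ 0) : C = 0 := by
  ext i j
  have h₁ := congrFun hv i
  have h₂ := congrFun hw i
  simp only [mulVec, dotProduct, Fin.sum_univ_two, Pi.zero_apply] at h₁ h₂
  rw [zero_apply]
  refine (mul_eq_zero.mp ?_).resolve_right h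
  fin_cases j <;> simp only [Fin.zero_eta, Fin.mk_one]
  · linear_combination w 1 * h₁ - v 1 * h₂
  · linear_combination v 0 * h₂ - w 0 * h₁

/-- Two vectors of `K²` with vanishing determinant, the first nonzero, are proportional. -/
theorem exists_eq_smul_of_det_eq_zero {v w : Fin 2 → K} (hv : v ≠ 0)
    (h : v 0 * w 1 - v 1 * w 0 = 0) : ∃ c : K, w = c • v := by
  by_cases h₀ : v 0 = 0
  · have h₁ : v 1 ≠ 0 := fun h₁ => hv (funext fun i => by fin_cases i <;> simp [h₀, h₁])
    refine ⟨w 1 / v 1, funext fun i => ?_⟩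
    fin_cases i <;> simp only [Pi.smul_apply, smul_eq_mul, Fin.zero_eta, Fin.mk_one] <;> grind
  · refine ⟨w 0 / v 0, funext fun i => ?_⟩
    fin_cases i <;> simp only [Pi.smul_apply, smul_eq_mul, Fin.zero_eta, Fin.mk_one] <;> grind

/-- If `μ = ±1` is an eigenvalue of `A ∈ SL₂`, then `A - μ` has trace zero. -/
theorem trace_sub_smul_one_eq_zero {A : Matrix (Fin 2) (Fin 2) K} (hA : A.det = 1)
    {v : Fin 2 → K} (hv : v ≠ 0) {μ : K} (h : (A - μ • 1) *ᵥ v = 0) (hμ : μ * μ = 1) :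
    (A - μ • 1).trace = 0 := by
  have hdet : (A - μ • 1).det = 0 := exists_mulVec_eq_zero_iff.mp ⟨v, hv, h⟩
  simp [det_fin_two] at hdet hA
  simp [trace_fin_two]
  grind

/-- If `N` conjugates `A` to its inverse and `v` is an eigenvector of `A` for `μ`, then `N v` is
an eigenvector of `A` for `μ⁻¹`. -/
theorem SpecialLinearGroup.smul_mulVec_of_conj_eq_inv {A N : SL(2, K)}
    (h : N⁻¹ * A * N = A⁻¹) {v : Fin 2 → K} {μ : K} (hv : A.1 *ᵥ v = μ • v) :
    μ • (A.1 *ᵥ (N.1 *ᵥ v)) = N.1 *ᵥ v := by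
  have hN : A * N * A = N := by
    rw [eq_inv_iff_mul_eq_one] at h
    calc A * N * A = N * (N⁻¹ * A * N * A) := by group
      _ = N := by rw [h, mul_one]
  have hN' : A.1 * N.1 * A.1 = N.1 := congrArg Subtype.val hN
  calc μ • (A.1 *ᵥ (N.1 *ᵥ v)) = (A.1 * N.1 * A.1) *ᵥ v := by
        rw [← mulVec_mulVec, hv, mulVec_smul, mulVec_mulVec]
    _ = N.1 *ᵥ v := by rw [hN']

end Matrix

theorem reducible_invariant_pair_is_abelian (A B : SL(2, ℂ))
    (hred : HasCommonEigenvector A B)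
    (M : SL(2, ℂ)) (hMA : M⁻¹ * A * M = A⁻¹) (hMB : M⁻¹ * B * M = B⁻¹) :
    A * B = B * A := by
  obtain ⟨v, hv, ⟨μ, hμ⟩, ν, hν⟩ := hred
  have hA := SpecialLinearGroup.smul_mulVec_of_conj_eq_inv hMA hμ
  have hB := SpecialLinearGroup.smul_mulVec_of_conj_eq_inv hMB hν
  have hw : M.1 *ᵥ v ≠ 0 := fun h =>
    one_ne_zero (M.2.symm.trans (exists_mulVec_eq_zero_iff.mp ⟨v, hv, h⟩))
  generalize M.1 *ᵥ v = w at hA hB hw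
  apply Subtype.ext
  change A.1 * B.1 = B.1 * A.1
  by_cases hdet : v 0 * w 1 - v 1 * w 0 = 0
  · obtain ⟨c, rfl⟩ := exists_eq_smul_of_det_eq_zero hv hdet
    have square_eq_one {X : Matrix (Fin 2) (Fin 2) ℂ} {t : ℂ} (hX : X *ᵥ v = t • v)
        (h : t • (X *ᵥ (c • v)) = c • v) : t * t = 1 := by
      refine smul_left_injective ℂ hw ?_
      change (t * t) • c • v = (1 : ℂ) • c • v
      rw [one_smul]
      conv_rhs => rw [← h, mulVec_smul, hX]
      module
    have kernel {X : Matrix (Fin 2) (Fin 2) ℂ} {t : ℂ} (hX : X *ᵥ v = t • v) :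
        (X - t • 1) *ᵥ v = 0 := by
      rw [sub_mulVec, smul_mulVec, one_mulVec, hX, sub_self]
    have hcomm := commute_of_trace_eq_zero_of_mulVec_eq_zero hv (kernel hμ) (kernel hν)
      (trace_sub_smul_one_eq_zero A.2 hv (kernel hμ) (square_eq_one hμ hA))
      (trace_sub_smul_one_eq_zero B.2 hv (kernel hν) (square_eq_one hν hB))
    simp only [sub_mul, mul_sub, smul_mul_assoc, mul_smul_comm, one_mul, mul_one] at hcomm
    rw [← sub_eq_zero] at hcomm ⊢
    rw [← hcomm]
    module
  · have hμ₀ : μ ≠ 0 := fun h => hw (by rw [← hA, h, zero_smul])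
    have hν₀ : ν ≠ 0 := fun h => hw (by rw [← hB, h, zero_smul])
    rw [← eq_inv_smul_iff₀ hμ₀] at hA
    rw [← eq_inv_smul_iff₀ hν₀] at hB
    refine sub_eq_zero.mp (eq_zero_of_mulVec_eq_zero_of_det_ne_zero ?_ ?_ hdet)
    · rw [sub_mulVec, ← mulVec_mulVec, ← mulVec_mulVec, hμ, hν, mulVec_smul, mulVec_smul, hμ, hν,
        smul_comm, sub_self]
    · rw [sub_mulVec, ← mulVec_mulVec, ← mulVec_mulVec, hA, hB, mulVec_smul, mulVec_smul, hA, hB,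
        smul_comm, sub_self]
end

section
/- Let M₀, M₁, M₂, M₃ ∈ SL(2,ℂ) satisfy M₀·M₁·M₂·M₃ = I and M₀² = M₁² = M₂² = −I. Set A = M₀M₁ and B = M₁M₂. Then the commutator satisfies A·B·A⁻¹·B⁻¹ = −M₀·M₃²·M₀⁻¹, and consequently tr(A·B·A⁻¹·B⁻¹) = 2 − (tr M₃)². -/
/-!
STATEMENT 8: Let M₀, M₁, M₂, M₃ ∈ SL(2,ℂ) with M₀M₁M₂M₃ = I and M₀² = M₁² = M₂² = −I.
Set A = M₀M₁ and B = M₁M₂. Then A·B·A⁻¹·B⁻¹ = −M₀·M₃²·M₀⁻¹ and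
tr(A·B·A⁻¹·B⁻¹) = 2 − (tr M₃)².
-/

open Matrix
open scoped MatrixGroups

theorem inv_eq_neg_of_sq_eq_neg_one {G : Type*} [Group G] [HasDistribNeg G] {g : G}
    (h : g ^ 2 = -1) : g⁻¹ = -g :=
  inv_eq_of_mul_eq_one_right (by rw [mul_neg, ← sq, h, neg_neg])

theorem commutator_mul_eq_neg_conj_sq {G : Type*} [Group G] [HasDistribNeg G] {a b c d : G}
    (hprod : a * b * c * d = 1) (ha : a ^ 2 = -1) (hb : b ^ 2 = -1) (hc : c ^ 2 = -1) :
    a * b * (b * c) * (a * b)⁻¹ * (b * c)⁻¹ = -(a * d ^ 2 * a⁻¹) := by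
  have hd : d = -(c * b * a) := by
    rw [← inv_eq_of_mul_eq_one_right hprod]
    simp [inv_eq_neg_of_sq_eq_neg_one, ha, hb, hc, mul_assoc]
  have hbc : a * b * (b * c) = -(a * c) := by
    rw [mul_assoc, ← mul_assoc b b c, ← sq, hb, neg_one_mul, mul_neg]
  rw [hbc, hd, neg_sq, sq, _root_.mul_inv_rev, _root_.mul_inv_rev, inv_eq_neg_of_sq_eq_neg_one hb,
    inv_eq_neg_of_sq_eq_neg_one hc, ← mul_assoc (c * b * a), ← mul_assoc a, mul_inv_cancel_right,
    inv_eq_neg_of_sq_eq_neg_one ha]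
  simp only [mul_neg, neg_mul, neg_neg, mul_assoc]

theorem Matrix.SpecialLinearGroup.trace_sq_fin_two {R : Type*} [CommRing R] (M : SL(2, R)) :
    Matrix.trace ((M ^ 2 : SL(2, R)) : Matrix (Fin 2) (Fin 2) R) =
      Matrix.trace (M : Matrix (Fin 2) (Fin 2) R) ^ 2 - 2 := by
  have hdet := M.det_coe
  rw [Matrix.det_fin_two] at hdet
  simp only [sq, SpecialLinearGroup.coe_mul, Matrix.trace_fin_two, Matrix.mul_apply,
    Fin.sum_univ_two]
  linear_combination -2 * hdet

theorem Matrix.SpecialLinearGroup.trace_conj {n R : Type*} [Fintype n] [DecidableEq n]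
    [CommRing R] (P M : SpecialLinearGroup n R) :
    Matrix.trace ((P * M * P⁻¹ : SpecialLinearGroup n R) : Matrix n n R) =
      Matrix.trace (M : Matrix n n R) := by
  rw [SpecialLinearGroup.coe_mul, Matrix.trace_mul_comm, ← SpecialLinearGroup.coe_mul,
    ← mul_assoc, inv_mul_cancel, one_mul]

theorem elliptic_pullback_commutator (M₀ M₁ M₂ M₃ : SL(2, ℂ))
    (hprod : M₀ * M₁ * M₂ * M₃ = 1)
    (h0 : M₀ ^ 2 = -1) (h1 : M₁ ^ 2 = -1) (h2 : M₂ ^ 2 = -1)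
    (A B : SL(2, ℂ)) (hA : A = M₀ * M₁) (hB : B = M₁ * M₂) :
    A * B * A⁻¹ * B⁻¹ = -(M₀ * M₃ ^ 2 * M₀⁻¹) ∧
    Matrix.trace ((A * B * A⁻¹ * B⁻¹ : SL(2, ℂ)) : Matrix (Fin 2) (Fin 2) ℂ) =
      2 - (Matrix.trace (M₃ : Matrix (Fin 2) (Fin 2) ℂ)) ^ 2 := by
  subst hA hB
  have hcomm := commutator_mul_eq_neg_conj_sq hprod h0 h1 h2
  refine ⟨hcomm, ?_⟩
  have hneg : ((-(M₀ * M₃ ^ 2 * M₀⁻¹) : SL(2, ℂ)) : Matrix (Fin 2) (Fin 2) ℂ) =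
      -((M₀ * M₃ ^ 2 * M₀⁻¹ : SL(2, ℂ)) : Matrix (Fin 2) (Fin 2) ℂ) :=
    SpecialLinearGroup.coe_neg _
  rw [hcomm, hneg, Matrix.trace_neg, SpecialLinearGroup.trace_conj,
    SpecialLinearGroup.trace_sq_fin_two]
  ring
end

section
/- Let A, B, M ∈ SL(2,ℂ) with tr(M) = 0, M⁻¹AM = A⁻¹ and M⁻¹BM = B⁻¹. Define M₀ := −AM, M₁ := M, M₂ := −MB, M₃ := B⁻¹MA⁻¹. Then M₀² = M₁² = M₂² = −I, the product relation M₀·M₁·M₂·M₃ = I holds, and M₀M₁ = A, M₁M₂ = B. In particular every pair (A,B) invariant under simultaneous inversion is the elliptic pull-back of a quadruple (M₀,M₁,M₂,M₃) with the first three matrices of order 4 and square −I. -/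
/-!
STATEMENT 9: Let A, B, M ∈ SL(2,ℂ) with tr(M) = 0, M⁻¹AM = A⁻¹ and M⁻¹BM = B⁻¹. Define
M₀ := −AM, M₁ := M, M₂ := −MB, M₃ := B⁻¹MA⁻¹. Then M₀² = M₁² = M₂² = −I,
M₀·M₁·M₂·M₃ = I, M₀M₁ = A and M₁M₂ = B.
-/

open Matrix
open scoped MatrixGroups

/-- A trace-zero element of `SL(2, R)` squares to `-1`. -/
theorem Matrix.SpecialLinearGroup.mul_self_eq_neg_one_of_trace_eq_zero {R : Type*} [CommRing R]
    (M : SL(2, R)) (htr : Matrix.trace (M : Matrix (Fin 2) (Fin 2) R) = 0) : M * M = -1 := by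
  have hdet := M.det_coe
  rw [Matrix.det_fin_two] at hdet
  rw [Matrix.trace_fin_two] at htr
  ext i j
  fin_cases i <;> fin_cases j <;> simp [Matrix.mul_apply, Fin.sum_univ_two]
  · linear_combination (M 0 0) * htr - hdet
  · linear_combination (M 0 1) * htr
  · linear_combination (M 1 0) * htr
  · linear_combination (M 1 1) * htr - hdet

/-- If `M` conjugates `A` to its inverse, then `A * M` and `M` have the same square. -/
theorem mul_mul_self_of_conj_eq_inv {G : Type*} [Group G] {A M : G}
    (h : M⁻¹ * A * M = A⁻¹) : A * M * (A * M) = M * M := by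
  have hAM : A * M = M * A⁻¹ := by rw [← h]; group
  nth_rewrite 1 [hAM]
  group

/-- If `M` conjugates `B` to its inverse, then `M * B` and `M` have the same square. -/
theorem mul_mul_self_of_conj_eq_inv' {G : Type*} [Group G] {B M : G}
    (h : M⁻¹ * B * M = B⁻¹) : M * B * (M * B) = M * M := by
  have hBM : B * M = M * B⁻¹ := by rw [← h]; group
  calc M * B * (M * B) = M * (B * M) * B := by group
    _ = M * M := by rw [hBM]; group

theorem inversion_invariant_pair_is_elliptic_pullback (A B M : SL(2, ℂ))
    (htr : Matrix.trace (M : Matrix (Fin 2) (Fin 2) ℂ) = 0)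
    (hMA : M⁻¹ * A * M = A⁻¹) (hMB : M⁻¹ * B * M = B⁻¹)
    (M₀ M₁ M₂ M₃ : SL(2, ℂ))
    (hM₀ : M₀ = -(A * M)) (hM₁ : M₁ = M) (hM₂ : M₂ = -(M * B))
    (hM₃ : M₃ = B⁻¹ * M * A⁻¹) :
    M₀ ^ 2 = -1 ∧ M₁ ^ 2 = -1 ∧ M₂ ^ 2 = -1 ∧
    M₀ * M₁ * M₂ * M₃ = 1 ∧ M₀ * M₁ = A ∧ M₁ * M₂ = B := by
  have hMM := Matrix.SpecialLinearGroup.mul_self_eq_neg_one_of_trace_eq_zero M htr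
  have hA : M₀ * M₁ = A := by rw [hM₀, hM₁, neg_mul, mul_assoc, hMM, mul_neg_one, neg_neg]
  have hB : M₁ * M₂ = B := by
    rw [hM₁, hM₂, mul_neg, ← mul_assoc, hMM, neg_one_mul, neg_neg]
  refine ⟨?_, ?_, ?_, ?_, hA, hB⟩
  · rw [hM₀, neg_sq, sq, mul_mul_self_of_conj_eq_inv hMA, hMM]
  · rw [hM₁, sq, hMM]
  · rw [hM₂, neg_sq, sq, mul_mul_self_of_conj_eq_inv' hMB, hMM]
  · calc M₀ * M₁ * M₂ * M₃ = -(A * (M * M) * A⁻¹) := by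
          rw [hA, hM₂, hM₃, mul_neg, neg_mul]
          group
      _ = 1 := by rw [hMM, mul_neg_one, neg_mul, neg_neg, mul_inv_cancel]
end

section
/- Let A, B ∈ SL(2,ℂ). Then the commutator A·B·A⁻¹·B⁻¹ equals −I if and only if tr(A) = tr(B) = tr(AB) = 0. (Such a pair generates the order 8 quaternionic subgroup of SL(2,ℂ) and corresponds to the unique singular point (0,0,0) of the Markov surface a² + b² + c² − abc = 0.) -/
/-!
STATEMENT 10: For A, B ∈ SL(2,ℂ), the commutator A·B·A⁻¹·B⁻¹ equals −I if and only if
tr(A) = tr(B) = tr(AB) = 0.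
-/

open Matrix
open scoped MatrixGroups

/-- The commutator of two elements is `-1` exactly when they anticommute. -/
theorem commutator_eq_neg_one_iff_anticommute {G : Type*} [Group G] [HasDistribNeg G] (A B : G) :
    A * B * A⁻¹ * B⁻¹ = -1 ↔ A * B = -(B * A) := by
  rw [mul_inv_eq_iff_eq_mul, mul_inv_eq_iff_eq_mul, neg_one_mul, neg_mul]

/-- A matrix anticommuting with an invertible one is conjugate to its negative, so its trace
vanishes. -/
theorem Matrix.trace_eq_zero_of_anticommute {n K : Type*} [Fintype n] [DecidableEq n] [Field K]
    [CharZero K] {M N : Matrix n n K} (hN : IsUnit N.det) (h : M * N = -(N * M)) :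
    M.trace = 0 := by
  have hM : M = -(N * M * N⁻¹) := by rw [← neg_mul, ← h, mul_nonsing_inv_cancel_right _ _ hN]
  have ht := congrArg trace hM
  rw [trace_neg, trace_mul_comm, nonsing_inv_mul_cancel_left _ _ hN] at ht
  exact self_eq_neg.mp ht

/-- Traceless `2 × 2` matrices with traceless product anticommute. -/
theorem Matrix.anticommute_of_traces_vanish {R : Type*} [CommRing R] {M N : Matrix (Fin 2) (Fin 2) R}
    (hM : M.trace = 0) (hN : N.trace = 0) (hMN : (M * N).trace = 0) : M * N = -(N * M) := by
  simp only [trace_fin_two, mul_apply, Fin.sum_univ_two] at hM hN hMN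
  ext i j
  fin_cases i <;> fin_cases j <;> simp [mul_apply, Fin.sum_univ_two] <;> grind

theorem commutator_eq_neg_one_iff_traces_vanish (A B : SL(2, ℂ)) :
    A * B * A⁻¹ * B⁻¹ = -1 ↔
      Matrix.trace (A : Matrix (Fin 2) (Fin 2) ℂ) = 0 ∧
      Matrix.trace (B : Matrix (Fin 2) (Fin 2) ℂ) = 0 ∧
      Matrix.trace ((A * B : SL(2, ℂ)) : Matrix (Fin 2) (Fin 2) ℂ) = 0 := by
  rw [commutator_eq_neg_one_iff_anticommute]
  constructor
  · intro h
    have hAB : A.1 * B.1 = -(B.1 * A.1) := congrArg Subtype.val h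
    refine ⟨trace_eq_zero_of_anticommute (by simp [B.2]) hAB,
      trace_eq_zero_of_anticommute (N := A.1) (by simp [A.2]) (by rw [hAB, neg_neg]), ?_⟩
    have ht := congrArg trace hAB
    rw [trace_neg, trace_mul_comm B.1] at ht
    exact self_eq_neg.mp ht
  · rintro ⟨hA, hB, hAB⟩
    exact Subtype.ext (anticommute_of_traces_vanish hA hB hAB)
end

section
/- Fix κ = (κ₀, κ₁, κ_t, κ_∞) ∈ ℂ⁴ and set ρ = (1 − κ₀ − κ₁ − κ_t − κ_∞)/2. Let U ⊆ ℂ∖{0,1} be open and let q, p : U → ℂ be differentiable with q(t) ∉ {0, 1, t} for all t ∈ U. Then (q,p) solves the Hamiltonian system HS(κ), i.e. q'(t) = ∂H/∂p(t, q(t), p(t)) and p'(t) = −∂H/∂q(t, q(t), p(t)) for all t ∈ U, if and only if q is twice differentiable, q solves the Painlevé VI equation PVI(κ) on U, and p is given for all t ∈ U by p(t) = (1/2)·( t(t−1)/(q(q−1)(q−t))·q'(t) + κ₀/q + κ₁/(q−1) + (κ_t − 1)/(q−t) ). -/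
noncomputable section

/-- The auxiliary parameter ρ = (1 − κ₀ − κ₁ − κ_t − κ_∞)/2. -/
def pvRho (κ0 κ1 κt κinf : ℂ) : ℂ := (1 - κ0 - κ1 - κt - κinf) / 2

/-- The Painlevé VI Hamiltonian
H(t,q,p) = [q(q−1)(q−t)/(t(t−1))]·(p² − (κ₀/q + κ₁/(q−1) + (κ_t−1)/(q−t))p
             + ρ(κ_∞+ρ)/(q(q−1))). -/
def pvH (κ0 κ1 κt κinf t q p : ℂ) : ℂ :=
  q * (q - 1) * (q - t) / (t * (t - 1)) *
    (p ^ 2 - (κ0 / q + κ1 / (q - 1) + (κt - 1) / (q - t)) * p +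
      pvRho κ0 κ1 κt κinf * (κinf + pvRho κ0 κ1 κt κinf) / (q * (q - 1)))

/-- Partial derivative ∂H/∂p of the Hamiltonian. -/
def pvHp (κ0 κ1 κt κinf t q p : ℂ) : ℂ := deriv (fun x => pvH κ0 κ1 κt κinf t q x) p

/-- Partial derivative ∂H/∂q of the Hamiltonian. -/
def pvHq (κ0 κ1 κt κinf t q p : ℂ) : ℂ := deriv (fun x => pvH κ0 κ1 κt κinf t x p) q

/-- `(q, p)` solves the non-autonomous Hamiltonian system
q' = ∂H/∂p, p' = −∂H/∂q on `U`. -/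
def IsHamiltonianSol (κ0 κ1 κt κinf : ℂ) (U : Set ℂ) (q p : ℂ → ℂ) : Prop :=
  ∀ t ∈ U,
    HasDerivAt q (pvHp κ0 κ1 κt κinf t (q t) (p t)) t ∧
    HasDerivAt p (-pvHq κ0 κ1 κt κinf t (q t) (p t)) t

/-- `lam` solves the Painlevé VI equation with parameters `(κ0, κ1, κt, κinf)` on `U`:
it avoids `0`, `1`, `t`, is twice differentiable, and satisfies the PVI ODE. -/
def IsPainleveVISol (κ0 κ1 κt κinf : ℂ) (U : Set ℂ) (lam : ℂ → ℂ) : Prop :=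
  ∀ t ∈ U,
    lam t ≠ 0 ∧ lam t ≠ 1 ∧ lam t ≠ t ∧
    DifferentiableAt ℂ lam t ∧ DifferentiableAt ℂ (deriv lam) t ∧
    deriv (deriv lam) t =
      1 / 2 * (1 / lam t + 1 / (lam t - 1) + 1 / (lam t - t)) * (deriv lam t) ^ 2
        - (1 / t + 1 / (t - 1) + 1 / (lam t - t)) * deriv lam t
        + lam t * (lam t - 1) * (lam t - t) / (t ^ 2 * (t - 1) ^ 2) *
            (κinf ^ 2 / 2 - κ0 ^ 2 / 2 * (t / (lam t) ^ 2)
              + κ1 ^ 2 / 2 * ((t - 1) / (lam t - 1) ^ 2)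
              + (1 - κt ^ 2) / 2 * (t * (t - 1) / (lam t - t) ^ 2))

/-!
STATEMENT 12: Fix κ ∈ ℂ⁴ and ρ = (1 − κ₀ − κ₁ − κ_t − κ_∞)/2. Let U ⊆ ℂ∖{0,1} be open and
q, p : U → ℂ differentiable with q(t) ∉ {0,1,t}. Then (q,p) solves the Hamiltonian system
HS(κ) iff q is twice differentiable, solves the Painlevé VI equation PVI(κ) on U, and
p = (1/2)(t(t−1)/(q(q−1)(q−t))·q' + κ₀/q + κ₁/(q−1) + (κ_t−1)/(q−t)).
-/

/-- The `p`-derivative of the Hamiltonian with denominators in `q` cleared. -/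
lemma pvHp_eq (κ0 κ1 κt κinf : ℂ) {t q : ℂ} (p : ℂ) (h0 : q ≠ 0) (h1 : q ≠ 1) (ht : q ≠ t) :
    pvHp κ0 κ1 κt κinf t q p =
      (2 * (q * (q - 1) * (q - t)) * p -
        (κ0 * ((q - 1) * (q - t)) + κ1 * (q * (q - t)) + (κt - 1) * (q * (q - 1)))) /
          (t * (t - 1)) := by
  have h1' := sub_ne_zero.mpr h1
  have ht' := sub_ne_zero.mpr ht
  have h := ((((hasDerivAt_id p).pow 2).sub ((hasDerivAt_id p).const_mul
    (κ0 / q + κ1 / (q - 1) + (κt - 1) / (q - t)))).add_const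
      (pvRho κ0 κ1 κt κinf * (κinf + pvRho κ0 κ1 κt κinf) / (q * (q - 1)))).const_mul
        (q * (q - 1) * (q - t) / (t * (t - 1)))
  refine h.deriv.trans ?_
  simp only [id]
  field_simp
  ring

/-- The `q`-derivative of the Hamiltonian with denominators in `q` cleared. -/
lemma pvHq_eq (κ0 κ1 κt κinf : ℂ) {t q : ℂ} (p : ℂ) (h0 : q ≠ 0) (h1 : q ≠ 1) (ht : q ≠ t) :
    pvHq κ0 κ1 κt κinf t q p =
      (((q - 1) * (q - t) + q * (q - t) + q * (q - 1)) * p ^ 2 -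
        (κ0 * (2 * q - 1 - t) + κ1 * (2 * q - t) + (κt - 1) * (2 * q - 1)) * p +
          pvRho κ0 κ1 κt κinf * (κinf + pvRho κ0 κ1 κt κinf)) / (t * (t - 1)) := by
  have hpoly : (fun x => pvH κ0 κ1 κt κinf t x p) =ᶠ[nhds q] fun x =>
      (x * (x - 1) * (x - t) * p ^ 2 -
        (κ0 * ((x - 1) * (x - t)) + κ1 * (x * (x - t)) + (κt - 1) * (x * (x - 1))) * p +
          pvRho κ0 κ1 κt κinf * (κinf + pvRho κ0 κ1 κt κinf) * (x - t)) / (t * (t - 1)) := by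
    filter_upwards [eventually_ne_nhds h0, eventually_ne_nhds h1, eventually_ne_nhds ht]
      with x h0 h1 ht
    have h1' := sub_ne_zero.mpr h1
    have ht' := sub_ne_zero.mpr ht
    unfold pvH
    generalize pvRho κ0 κ1 κt κinf = r
    field_simp
  have d0 := hasDerivAt_id' q
  have d1 := d0.sub_const 1
  have dt := d0.sub_const t
  have h := (((((d0.mul d1).mul dt).mul_const (p ^ 2)).sub
    (((((d1.mul dt).const_mul κ0).add ((d0.mul dt).const_mul κ1)).add
      ((d0.mul d1).const_mul (κt - 1))).mul_const p)).add
        (dt.const_mul (pvRho κ0 κ1 κt κinf * (κinf + pvRho κ0 κ1 κt κinf)))).div_const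
          (t * (t - 1))
  refine hpoly.deriv_eq.trans (h.deriv.trans ?_)
  simp only [Pi.mul_apply]
  ring

/-- Solving the first Hamilton equation `q' = ∂H/∂p` for `p`. -/
lemma eq_pvHp_iff (κ0 κ1 κt κinf : ℂ) {t q : ℂ} (p a : ℂ) (t0 : t ≠ 0) (t1 : t ≠ 1)
    (h0 : q ≠ 0) (h1 : q ≠ 1) (ht : q ≠ t) :
    a = pvHp κ0 κ1 κt κinf t q p ↔
      p = 1 / 2 * (t * (t - 1) / (q * (q - 1) * (q - t)) * a
            + κ0 / q + κ1 / (q - 1) + (κt - 1) / (q - t)) := by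
  have h1' := sub_ne_zero.mpr h1
  have ht' := sub_ne_zero.mpr ht
  have t1' := sub_ne_zero.mpr t1
  rw [pvHp_eq κ0 κ1 κt κinf p h0 h1 ht]
  constructor
  · rintro rfl
    field_simp
    ring
  · rintro rfl
    field_simp
    ring

/-- The derivative of `q' = ∂H/∂p` along a curve `(q, p)` satisfying the first Hamilton equation
differs from the right-hand side of PVI by a multiple of the defect of the second one. -/
lemma hasDerivAt_deriv_of_eventually_eq_pvHp (κ0 κ1 κt κinf : ℂ) {t : ℂ} {q p : ℂ → ℂ}
    (t0 : t ≠ 0) (t1 : t ≠ 1) (h0 : q t ≠ 0) (h1 : q t ≠ 1) (ht : q t ≠ t)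
    (hq : DifferentiableAt ℂ q t) (hp : DifferentiableAt ℂ p t)
    (hev : ∀ᶠ s in nhds t, deriv q s = pvHp κ0 κ1 κt κinf s (q s) (p s)) :
    HasDerivAt (deriv q)
      (1 / 2 * (1 / q t + 1 / (q t - 1) + 1 / (q t - t)) * (deriv q t) ^ 2
        - (1 / t + 1 / (t - 1) + 1 / (q t - t)) * deriv q t
        + q t * (q t - 1) * (q t - t) / (t ^ 2 * (t - 1) ^ 2) *
            (κinf ^ 2 / 2 - κ0 ^ 2 / 2 * (t / (q t) ^ 2)
              + κ1 ^ 2 / 2 * ((t - 1) / (q t - 1) ^ 2)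
              + (1 - κt ^ 2) / 2 * (t * (t - 1) / (q t - t) ^ 2))
        + 2 * (q t * (q t - 1) * (q t - t)) / (t * (t - 1)) *
            (deriv p t + pvHq κ0 κ1 κt κinf t (q t) (p t))) t := by
  have h1' := sub_ne_zero.mpr h1
  have ht' := sub_ne_zero.mpr ht
  have t1' := sub_ne_zero.mpr t1
  have hrat : deriv q =ᶠ[nhds t] fun s =>
      (2 * (q s * (q s - 1) * (q s - s)) * p s -
        (κ0 * ((q s - 1) * (q s - s)) + κ1 * (q s * (q s - s)) +
          (κt - 1) * (q s * (q s - 1)))) / (s * (s - 1)) := by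
    filter_upwards [hev, hq.continuousAt.eventually_ne h0, hq.continuousAt.eventually_ne h1,
      (hq.continuousAt.sub continuousAt_id).eventually_ne ht'] with s hs h0 h1 ht
    exact hs.trans (pvHp_eq κ0 κ1 κt κinf (p s) h0 h1 (sub_ne_zero.mp ht))
  have dq := hq.hasDerivAt
  have ds := hasDerivAt_id' t
  have d1 := dq.sub_const 1
  have dt := dq.sub ds
  have h := ((((((dq.mul d1).mul dt).const_mul 2).mul hp.hasDerivAt).sub
    ((((d1.mul dt).const_mul κ0).add ((dq.mul dt).const_mul κ1)).add
      ((dq.mul d1).const_mul (κt - 1)))).div (ds.mul (ds.sub_const 1)) (mul_ne_zero t0 t1'))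
  refine (h.congr_of_eventuallyEq hrat).congr_deriv ?_
  have hd := hrat.self_of_nhds
  beta_reduce at hd
  rw [pvHq_eq κ0 κ1 κt κinf (p t) h0 h1 ht]
  simp only [Pi.mul_apply, Pi.sub_apply, Pi.add_apply, pvRho]
  clear h dt d1 dq hrat hev hq hp
  generalize deriv q t = a at *
  generalize deriv p t = b at *
  generalize q t = x at *
  generalize p t = y at *
  subst hd
  field_simp
  ring

theorem hamiltonian_system_iff_painleveVI
    (κ0 κ1 κt κinf : ℂ) (U : Set ℂ) (hU : IsOpen U)
    (hU01 : ∀ t ∈ U, t ≠ 0 ∧ t ≠ 1)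
    (q p : ℂ → ℂ)
    (hqdiff : ∀ t ∈ U, DifferentiableAt ℂ q t)
    (hpdiff : ∀ t ∈ U, DifferentiableAt ℂ p t)
    (hreg : ∀ t ∈ U, q t ≠ 0 ∧ q t ≠ 1 ∧ q t ≠ t) :
    IsHamiltonianSol κ0 κ1 κt κinf U q p ↔
      (IsPainleveVISol κ0 κ1 κt κinf U q ∧
        ∀ t ∈ U, p t =
          1 / 2 * (t * (t - 1) / (q t * (q t - 1) * (q t - t)) * deriv q t
            + κ0 / q t + κ1 / (q t - 1) + (κt - 1) / (q t - t))) := by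
  have hfirst : ∀ t ∈ U, (deriv q t = pvHp κ0 κ1 κt κinf t (q t) (p t) ↔ _) := fun t htU =>
    eq_pvHp_iff κ0 κ1 κt κinf (p t) (deriv q t) (hU01 t htU).1 (hU01 t htU).2
      (hreg t htU).1 (hreg t htU).2.1 (hreg t htU).2.2
  have hsecond (hev : ∀ t ∈ U, deriv q t = pvHp κ0 κ1 κt κinf t (q t) (p t)) (t) (htU : t ∈ U) :=
    hasDerivAt_deriv_of_eventually_eq_pvHp κ0 κ1 κt κinf (hU01 t htU).1 (hU01 t htU).2
      (hreg t htU).1 (hreg t htU).2.1 (hreg t htU).2.2 (hqdiff t htU) (hpdiff t htU)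
      (Filter.eventually_of_mem (hU.mem_nhds htU) hev)
  constructor
  · intro hH
    have hev : ∀ t ∈ U, deriv q t = pvHp κ0 κ1 κt κinf t (q t) (p t) :=
      fun t htU => (hH t htU).1.deriv
    refine ⟨fun t htU => ?_, fun t htU => (hfirst t htU).mp (hev t htU)⟩
    have hd := hsecond hev t htU
    obtain ⟨h0, h1, ht⟩ := hreg t htU
    refine ⟨h0, h1, ht, hqdiff t htU, hd.differentiableAt, ?_⟩
    rw [hd.deriv, (hH t htU).2.deriv, neg_add_cancel, mul_zero, add_zero]
  · rintro ⟨hP, hp⟩ t htU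
    have hev : ∀ t ∈ U, deriv q t = pvHp κ0 κ1 κt κinf t (q t) (p t) :=
      fun t htU => (hfirst t htU).mpr (hp t htU)
    have hd := (hsecond hev t htU).deriv
    obtain ⟨h0, h1, ht, -, -, hode⟩ := hP t htU
    obtain ⟨t0, t1⟩ := hU01 t htU
    refine ⟨hev t htU ▸ (hqdiff t htU).hasDerivAt, ?_⟩
    have hdefect := left_eq_add.mp (hode.symm.trans hd)
    have hcoeff : 2 * (q t * (q t - 1) * (q t - t)) / (t * (t - 1)) ≠ 0 := by
      simp [sub_eq_zero, *]
    rw [← eq_neg_of_add_eq_zero_left ((mul_eq_zero.mp hdefect).resolve_left hcoeff)]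
    exact (hpdiff t htU).hasDerivAt
end
end

section
/- Fix κ = (κ₀, κ₁, κ_t, κ_∞) ∈ ℂ⁴ and set ρ = (1 − κ₀ − κ₁ − κ_t − κ_∞)/2. Let U ⊆ ℂ∖{0,1} be open and let (q,p) : U → ℂ² be differentiable, solving the Hamiltonian system HS(κ) with q(t) ∉ {0, 1, t} and p(t) ≠ 0 for all t ∈ U, and assume q(t) + (ρ + κ_∞)/p(t) ∉ {0, 1, t} for all t ∈ U. Then the pair (q̃, p̃) := (q + (ρ + κ_∞)/p, p) solves the Hamiltonian system HS(κ̃) for the parameters κ̃ = (κ₀ + ρ + κ_∞, κ₁ + ρ + κ_∞, κ_t + ρ + κ_∞, −ρ). (This is the Okamoto symmetry s₂s₁s₂, the conjugate of s₂ by the sign change κ_∞ ↦ −κ_∞.) -/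
noncomputable section

/-- The Hamiltonian as a polynomial in `q` and `p`, away from its removable singularities. -/
theorem pvH_eq_polynomial (κ0 κ1 κt κinf t q p : ℂ) (h0 : q ≠ 0) (h1 : q ≠ 1) (ht : q ≠ t) :
    pvH κ0 κ1 κt κinf t q p =
      (q * (q - 1) * (q - t) * p ^ 2
        - (κ0 * ((q - 1) * (q - t)) + κ1 * (q * (q - t)) + (κt - 1) * (q * (q - 1))) * p
        + pvRho κ0 κ1 κt κinf * (κinf + pvRho κ0 κ1 κt κinf) * (q - t)) / (t * (t - 1)) := by
  have h1' := sub_ne_zero.mpr h1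
  have ht' := sub_ne_zero.mpr ht
  rw [pvH, div_mul_eq_mul_div]
  congr 1
  field_simp

theorem pvHp_eq_polynomial (κ0 κ1 κt κinf t q p : ℂ) (h0 : q ≠ 0) (h1 : q ≠ 1) (ht : q ≠ t) :
    pvHp κ0 κ1 κt κinf t q p =
      (2 * (q * (q - 1) * (q - t)) * p
        - (κ0 * ((q - 1) * (q - t)) + κ1 * (q * (q - t)) + (κt - 1) * (q * (q - 1))))
        / (t * (t - 1)) := by
  simp only [pvHp, pvH_eq_polynomial κ0 κ1 κt κinf t q _ h0 h1 ht]
  have hx := hasDerivAt_id' p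
  refine (((((hx.pow 2).const_mul (q * (q - 1) * (q - t))).sub
    (hx.const_mul (κ0 * ((q - 1) * (q - t)) + κ1 * (q * (q - t))
      + (κt - 1) * (q * (q - 1))))).add_const
    (pvRho κ0 κ1 κt κinf * (κinf + pvRho κ0 κ1 κt κinf) * (q - t))).div_const (t * (t - 1))).deriv.trans ?_
  push_cast
  ring

theorem pvHq_eq_polynomial (κ0 κ1 κt κinf t q p : ℂ) (h0 : q ≠ 0) (h1 : q ≠ 1) (ht : q ≠ t) :
    pvHq κ0 κ1 κt κinf t q p =
      (((q - 1) * (q - t) + q * (q - t) + q * (q - 1)) * p ^ 2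
        - (κ0 * (2 * q - 1 - t) + κ1 * (2 * q - t) + (κt - 1) * (2 * q - 1)) * p
        + pvRho κ0 κ1 κt κinf * (κinf + pvRho κ0 κ1 κt κinf)) / (t * (t - 1)) := by
  have hx := hasDerivAt_id' q
  have hx1 := hx.sub_const 1
  have hxt := hx.sub_const t
  have key := ((((((hx.mul hx1).mul hxt).mul_const (p ^ 2)).sub
    (((((hx1.mul hxt).const_mul κ0).add ((hx.mul hxt).const_mul κ1)).add
      ((hx.mul hx1).const_mul (κt - 1))).mul_const p)).add
    (hxt.const_mul (pvRho κ0 κ1 κt κinf * (κinf + pvRho κ0 κ1 κt κinf))))).div_const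
      (t * (t - 1))
  refine (key.congr_of_eventuallyEq ?_).deriv.trans ?_
  · filter_upwards [isOpen_ne.mem_nhds h0, isOpen_ne.mem_nhds h1, isOpen_ne.mem_nhds ht]
      with x hx0 hx1 hxt
    exact pvH_eq_polynomial κ0 κ1 κt κinf t x p hx0 hx1 hxt
  · simp only [Pi.mul_apply]
    ring

/-!
STATEMENT 14: If (q,p) is a differentiable solution of the Hamiltonian system HS(κ) on an
open set U ⊆ ℂ∖{0,1}, with q(t) ∉ {0,1,t}, p(t) ≠ 0 and q(t) + (ρ+κ_∞)/p(t) ∉ {0,1,t} on U,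
then (q + (ρ+κ_∞)/p, p) solves the Hamiltonian system
HS(κ₀+ρ+κ_∞, κ₁+ρ+κ_∞, κ_t+ρ+κ_∞, −ρ). (Okamoto symmetry s₂s₁s₂.)
-/

theorem okamoto_symmetry_s2s1s2
    (κ0 κ1 κt κinf : ℂ) (U : Set ℂ) (hU : IsOpen U)
    (hU01 : ∀ t ∈ U, t ≠ 0 ∧ t ≠ 1)
    (q p : ℂ → ℂ)
    (hsol : IsHamiltonianSol κ0 κ1 κt κinf U q p)
    (hreg : ∀ t ∈ U, q t ≠ 0 ∧ q t ≠ 1 ∧ q t ≠ t)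
    (hpne : ∀ t ∈ U, p t ≠ 0)
    (hregnew : ∀ t ∈ U,
      q t + (pvRho κ0 κ1 κt κinf + κinf) / p t ≠ 0 ∧
      q t + (pvRho κ0 κ1 κt κinf + κinf) / p t ≠ 1 ∧
      q t + (pvRho κ0 κ1 κt κinf + κinf) / p t ≠ t) :
    IsHamiltonianSol (κ0 + pvRho κ0 κ1 κt κinf + κinf) (κ1 + pvRho κ0 κ1 κt κinf + κinf)
      (κt + pvRho κ0 κ1 κt κinf + κinf) (-(pvRho κ0 κ1 κt κinf)) U
      (fun t => q t + (pvRho κ0 κ1 κt κinf + κinf) / p t) p := by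
  intro t htU
  obtain ⟨ht0, ht1⟩ := hU01 t htU
  obtain ⟨h0, h1, ht⟩ := hreg t htU
  obtain ⟨n0, n1, nt⟩ := hregnew t htU
  obtain ⟨hq, hp⟩ := hsol t htU
  have hpt := hpne t htU
  have ht1' := sub_ne_zero.mpr ht1
  rw [pvHp_eq_polynomial _ _ _ _ _ _ _ h0 h1 ht] at hq
  rw [pvHq_eq_polynomial _ _ _ _ _ _ _ h0 h1 ht] at hp
  rw [pvHp_eq_polynomial _ _ _ _ _ _ _ n0 n1 nt, pvHq_eq_polynomial _ _ _ _ _ _ _ n0 n1 nt]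
  constructor
  · refine (hq.add ((hasDerivAt_const t (pvRho κ0 κ1 κt κinf + κinf)).div hp hpt)).congr_deriv ?_
    simp only [pvRho]
    field_simp
    ring
  · refine hp.congr_deriv ?_
    simp only [pvRho]
    field_simp
    ring
end
end

section
/- Let ϑ ∈ ℂ and let U ⊆ ℂ∖{0,1} be open. Suppose q : U → ℂ solves the Painlevé VI equation PVI(1/2, 1/2, 1/2, (ϑ−1)/2) on U, define p(t) = (1/2)·( t(t−1)/(q(q−1)(q−t))·q'(t) + 1/(2q) + 1/(2(q−1)) − 1/(2(q−t)) ), and assume p(t) ≠ 0 and λ(t) := q(t) + (ϑ−2)/(4·p(t)) ∉ {0, 1, t} for all t ∈ U. Then λ solves the Painlevé VI equation PVI(ϑ/4, ϑ/4, ϑ/4, ϑ/4) on U. (This is the analytic content of the main theorem: the Tu invariant λ(E_t) of the vector bundle along the isomonodromic deformation of an irreducible Lamé connection with exponent ϑ is a Painlevé VI solution with parameters (ϑ/4, ϑ/4, ϑ/4, ϑ/4), obtained from the Painlevé VI solution q parametrizing the pushed-down deformation by the Okamoto symmetry s₂s₁s₂.) -/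
noncomputable section

/-- `(q, p)` solves on `U` the polynomial Hamiltonian system equivalent to the Painlevé VI equation
with parameters `(κ0, κ1, κt, κinf)`. -/
def IsPainleveVIHamiltonianSol (κ0 κ1 κt κinf : ℂ) (U : Set ℂ) (q p : ℂ → ℂ) : Prop :=
  ∀ t ∈ U,
    HasDerivAt q
      ((2 * q t * (q t - 1) * (q t - t) * p t - κ0 * (q t - 1) * (q t - t)
        - κ1 * q t * (q t - t) - (κt - 1) * q t * (q t - 1)) / (t * (t - 1))) t ∧
    HasDerivAt p
      (-((3 * q t ^ 2 - 2 * (1 + t) * q t + t) * p t ^ 2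
        - (κ0 * (2 * q t - 1 - t) + κ1 * (2 * q t - t) + (κt - 1) * (2 * q t - 1)) * p t
        + ((κ0 + κ1 + κt - 1) ^ 2 - κinf ^ 2) / 4) / (t * (t - 1))) t

/-- A solution of Painlevé VI, together with its conjugate momentum, solves the Hamiltonian
system. -/
theorem IsPainleveVISol.isPainleveVIHamiltonianSol {κ0 κ1 κt κinf : ℂ} {U : Set ℂ}
    {q p : ℂ → ℂ} (hU : IsOpen U) (hU01 : ∀ t ∈ U, t ≠ 0 ∧ t ≠ 1)
    (hq : IsPainleveVISol κ0 κ1 κt κinf U q)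
    (hp : ∀ t ∈ U, p t = (t * (t - 1) * deriv q t + κ0 * (q t - 1) * (q t - t)
      + κ1 * q t * (q t - t) + (κt - 1) * q t * (q t - 1)) / (2 * q t * (q t - 1) * (q t - t))) :
    IsPainleveVIHamiltonianSol κ0 κ1 κt κinf U q p := by
  intro t ht
  obtain ⟨ht0, ht1⟩ := hU01 t ht
  obtain ⟨hq0, hq1, hqt, hdq, hddq, hode⟩ := hq t ht
  have ht1' : t - 1 ≠ 0 := sub_ne_zero.2 ht1
  have hq1' : q t - 1 ≠ 0 := sub_ne_zero.2 hq1
  have hqt' : q t - t ≠ 0 := sub_ne_zero.2 hqt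
  have hQ := hdq.hasDerivAt
  have hQ' := hddq.hasDerivAt
  have hid := hasDerivAt_id' t
  have hQ1 := hQ.sub_const 1
  have hQt := hQ.fun_sub hid
  refine ⟨?_, ?_⟩
  · refine hQ.congr_deriv ?_
    rw [hp t ht]
    field_simp
    ring
  · have hnum := ((((hid.fun_mul (hid.sub_const 1)).fun_mul hQ').fun_add
      ((hQ1.const_mul κ0).fun_mul hQt)).fun_add ((hQ.const_mul κ1).fun_mul hQt)).fun_add
      ((hQ.const_mul (κt - 1)).fun_mul hQ1)
    have hden := ((hQ.const_mul 2).fun_mul hQ1).fun_mul hQt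
    have hquot := (hnum.fun_div hden (by simp [hq0, hq1', hqt'])).congr_of_eventuallyEq
      (Filter.eventually_of_mem (hU.mem_nhds ht) hp)
    refine hquot.congr_deriv ?_
    rw [hp t ht, hode]
    generalize deriv q t = x
    generalize q t = y at *
    field_simp
    ring

/-- The position component of a solution of the Hamiltonian system solves Painlevé VI wherever it
avoids `0`, `1` and `t`. -/
theorem IsPainleveVIHamiltonianSol.isPainleveVISol {κ0 κ1 κt κinf : ℂ} {U : Set ℂ}
    {q p : ℂ → ℂ} (hU : IsOpen U) (hU01 : ∀ t ∈ U, t ≠ 0 ∧ t ≠ 1)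
    (h : IsPainleveVIHamiltonianSol κ0 κ1 κt κinf U q p)
    (hreg : ∀ t ∈ U, q t ≠ 0 ∧ q t ≠ 1 ∧ q t ≠ t) :
    IsPainleveVISol κ0 κ1 κt κinf U q := by
  intro t ht
  obtain ⟨ht0, ht1⟩ := hU01 t ht
  obtain ⟨hq0, hq1, hqt⟩ := hreg t ht
  obtain ⟨hQ, hP⟩ := h t ht
  have ht1' : t - 1 ≠ 0 := sub_ne_zero.2 ht1
  have hq1' : q t - 1 ≠ 0 := sub_ne_zero.2 hq1
  have hqt' : q t - t ≠ 0 := sub_ne_zero.2 hqt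
  have hid := hasDerivAt_id' t
  have hQ1 := hQ.sub_const 1
  have hQt := hQ.fun_sub hid
  have hnum := (((((((hQ.const_mul 2).fun_mul hQ1).fun_mul hQt).fun_mul hP)).fun_sub
    ((hQ1.const_mul κ0).fun_mul hQt)).fun_sub ((hQ.const_mul κ1).fun_mul hQt)).fun_sub
    ((hQ.const_mul (κt - 1)).fun_mul hQ1)
  have hQ' := (hnum.fun_div (hid.fun_mul (hid.sub_const 1))
    (mul_ne_zero ht0 ht1')).congr_of_eventuallyEq
    (Filter.eventually_of_mem (hU.mem_nhds ht) fun s hs => (h s hs).1.deriv)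
  refine ⟨hq0, hq1, hqt, hQ.differentiableAt, hQ'.differentiableAt, ?_⟩
  rw [hQ'.deriv, hQ.deriv]
  generalize p t = x
  generalize q t = y at *
  field_simp
  ring

/-- Okamoto's birational symmetry `q ↦ q + c / p` of the Painlevé VI Hamiltonian system. -/
theorem IsPainleveVIHamiltonianSol.add_div {κ0 κ1 κt κinf c : ℂ} {U : Set ℂ}
    {q p : ℂ → ℂ} (hU01 : ∀ t ∈ U, t ≠ 0 ∧ t ≠ 1)
    (h : IsPainleveVIHamiltonianSol κ0 κ1 κt κinf U q p) (hpne : ∀ t ∈ U, p t ≠ 0)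
    (hc : c = (1 - κ0 - κ1 - κt + κinf) / 2) :
    IsPainleveVIHamiltonianSol (κ0 + c) (κ1 + c) (κt + c) (c - κinf) U
      (fun t => q t + c / p t) p := by
  intro t ht
  obtain ⟨ht0, ht1⟩ := hU01 t ht
  obtain ⟨hQ, hP⟩ := h t ht
  have ht1' : t - 1 ≠ 0 := sub_ne_zero.2 ht1
  have hp0 := hpne t ht
  obtain rfl : κinf = 2 * c - 1 + κ0 + κ1 + κt := by rw [hc]; ring
  refine ⟨?_, ?_⟩
  · refine (hQ.fun_add ((hasDerivAt_const t c).fun_div hP hp0)).congr_deriv ?_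
    field_simp
    ring
  · refine hP.congr_deriv ?_
    field_simp
    ring

/-!
STATEMENT 15: Let ϑ ∈ ℂ and U ⊆ ℂ∖{0,1} open. If q solves PVI(1/2, 1/2, 1/2, (ϑ−1)/2) on U,
p is defined by p = (1/2)(t(t−1)/(q(q−1)(q−t))·q' + 1/(2q) + 1/(2(q−1)) − 1/(2(q−t))),
p(t) ≠ 0 and λ := q + (ϑ−2)/(4p) avoids {0,1,t} on U, then λ solves
PVI(ϑ/4, ϑ/4, ϑ/4, ϑ/4) on U. (Main theorem: the Tu invariant of the bundle along the
isomonodromic deformation of an irreducible Lamé connection is a Painlevé VI transcendent.)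
-/

theorem lame_tu_invariant_is_painleveVI
    (ϑ : ℂ) (U : Set ℂ) (hU : IsOpen U)
    (hU01 : ∀ t ∈ U, t ≠ 0 ∧ t ≠ 1)
    (q : ℂ → ℂ)
    (hq : IsPainleveVISol (1 / 2) (1 / 2) (1 / 2) ((ϑ - 1) / 2) U q)
    (p : ℂ → ℂ)
    (hp : ∀ t ∈ U, p t =
      1 / 2 * (t * (t - 1) / (q t * (q t - 1) * (q t - t)) * deriv q t
        + 1 / (2 * q t) + 1 / (2 * (q t - 1)) - 1 / (2 * (q t - t))))
    (hpne : ∀ t ∈ U, p t ≠ 0)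
    (lam : ℂ → ℂ)
    (hlam : ∀ t ∈ U, lam t = q t + (ϑ - 2) / (4 * p t))
    (hreg : ∀ t ∈ U, lam t ≠ 0 ∧ lam t ≠ 1 ∧ lam t ≠ t) :
    IsPainleveVISol (ϑ / 4) (ϑ / 4) (ϑ / 4) (ϑ / 4) U lam := by
  have hmom : ∀ t ∈ U, p t = (t * (t - 1) * deriv q t + 1 / 2 * (q t - 1) * (q t - t)
      + 1 / 2 * q t * (q t - t) + (1 / 2 - 1) * q t * (q t - 1))
      / (2 * q t * (q t - 1) * (q t - t)) := by
    intro t ht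
    obtain ⟨hq0, hq1, hqt, -⟩ := hq t ht
    have hq1' : q t - 1 ≠ 0 := sub_ne_zero.2 hq1
    have hqt' : q t - t ≠ 0 := sub_ne_zero.2 hqt
    rw [hp t ht]
    field_simp
    ring
  have hham := (hq.isPainleveVIHamiltonianSol hU hU01 hmom).add_div (c := (ϑ - 2) / 4) hU01 hpne
    (by ring)
  have hlam' : ∀ t ∈ U, lam t = q t + (ϑ - 2) / 4 / p t := fun t ht => by
    rw [hlam t ht, div_div]
  have hham' : IsPainleveVIHamiltonianSol (ϑ / 4) (ϑ / 4) (ϑ / 4) (ϑ / 4) U lam p := by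
    intro t ht
    obtain ⟨hQ, hP⟩ := hham t ht
    rw [hlam' t ht]
    refine ⟨?_, ?_⟩
    · refine (hQ.congr_of_eventuallyEq
        (Filter.eventually_of_mem (hU.mem_nhds ht) hlam')).congr_deriv ?_
      ring
    · refine hP.congr_deriv ?_
      ring
  exact hham'.isPainleveVISol hU hU01 hreg
end
end

section
/- Fix complex numbers κ₀, κ₁, κ_t, κ_∞, t, q, p with t ∉ {0,1}, q ∉ {0, 1, t}, p ≠ 0, set ρ = (1 − κ₀ − κ₁ − κ_t − κ_∞)/2 and 𝐩 = q(q−1)(q−t)p, and assume (q−t)p + ρ + κ_∞ ≠ 0. Define the affine parabolic directions l₀ = 𝐩/q, l₁ = 𝐩/(q−1) + ρ + κ_∞, l_t = 𝐩/(q−t) + (ρ + κ_∞)·t (the fourth direction being l_∞ = ∞), and assume l₁ ≠ l₀. Then their cross-ratio c := (l_t − l₀)/(l₁ − l₀) equals t·((q−1)p + ρ + κ_∞)/((q−t)p + ρ + κ_∞), and, provided c ≠ t, one has t·(c − 1)/(c − t) = q + (ρ + κ_∞)/p. Thus the Tu invariant λ = t(c−1)/(c−t) of the elliptic pull-back equals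 q + (ρ + κ_∞)/p. -/
/-!
STATEMENT 19: With ρ = (1 − κ₀ − κ₁ − κ_t − κ_∞)/2, 𝐩 = q(q−1)(q−t)p, and parabolic
directions l₀ = 𝐩/q, l₁ = 𝐩/(q−1) + ρ + κ_∞, l_t = 𝐩/(q−t) + (ρ+κ_∞)t (and l_∞ = ∞),
assuming t ∉ {0,1}, q ∉ {0,1,t}, p ≠ 0, (q−t)p + ρ + κ_∞ ≠ 0 and l₁ ≠ l₀, the cross-ratio
c = (l_t − l₀)/(l₁ − l₀) equals t((q−1)p + ρ + κ_∞)/((q−t)p + ρ + κ_∞) and, provided c ≠ t,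
the Tu invariant λ = t(c−1)/(c−t) of the elliptic pull-back equals q + (ρ+κ_∞)/p.
-/

theorem cross_ratio_and_tu_invariant
    (κ0 κ1 κt κinf t q p ρ bp l0 l1 lt c : ℂ)
    (ht0 : t ≠ 0) (ht1 : t ≠ 1)
    (hq0 : q ≠ 0) (hq1 : q ≠ 1) (hqt : q ≠ t)
    (hp : p ≠ 0)
    (hρ : ρ = (1 - κ0 - κ1 - κt - κinf) / 2)
    (hbp : bp = q * (q - 1) * (q - t) * p)
    (hl0 : l0 = bp / q)
    (hl1 : l1 = bp / (q - 1) + ρ + κinf)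
    (hlt : lt = bp / (q - t) + (ρ + κinf) * t)
    (hden : (q - t) * p + ρ + κinf ≠ 0)
    (hl10 : l1 ≠ l0)
    (hc : c = (lt - l0) / (l1 - l0)) :
    c = t * ((q - 1) * p + ρ + κinf) / ((q - t) * p + ρ + κinf) ∧
    (c ≠ t → t * (c - 1) / (c - t) = q + (ρ + κinf) / p) := by
  have hq1' : q - 1 ≠ 0 := sub_ne_zero.mpr hq1
  have hqt' : q - t ≠ 0 := sub_ne_zero.mpr hqt
  have ht1' : t - 1 ≠ 0 := sub_ne_zero.mpr ht1
  have h10 : l1 - l0 = (q - t) * p + ρ + κinf := by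
    rw [hl1, hl0, hbp]
    field_simp
    ring
  have ht : lt - l0 = t * ((q - 1) * p + ρ + κinf) := by
    rw [hlt, hl0, hbp]
    field_simp
    ring
  have hc' : c = t * ((q - 1) * p + ρ + κinf) / ((q - t) * p + ρ + κinf) := by
    rw [hc, h10, ht]
  refine ⟨hc', fun _ => ?_⟩
  have hsub_one : c - 1 = (t - 1) * (q * p + ρ + κinf) / ((q - t) * p + ρ + κinf) := by
    rw [hc', div_sub_one hden]
    ring
  have hsub_t : c - t = t * (t - 1) * p / ((q - t) * p + ρ + κinf) := by
    rw [hc', div_sub' hden]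
    ring
  rw [hsub_one, hsub_t, ← mul_div_assoc, div_div_div_cancel_right₀ hden]
  field_simp
  ring
end
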